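/- There exist non-compact strictly singular bounded operators on Z₂, but the product of two strictly singular operators on Z₂ is compact. Precisely: (1) the operator S(ω,x) = (x, 0) on pairs of real sequences is bounded on Z₂, strictly singular, and not compact; (2) if S and T are linear maps on pairs of real sequences, both bounded on Z₂ and strictly singular, then the composition S∘T is compact on Z₂. -/

import Mathlib

open scoped BigOperators

noncomputable section

/-- Real sequences. -/
abbrev RSeq : Type := ℕ → ℝ

/-- Membership in ℓ². -/
def memL2 (x : RSeq) : Prop := Summable (fun n => (x n) ^ 2)

/-- The ℓ² norm. -/
noncomputable def l2norm (x : RSeq) : ℝ := Real.sqrt (∑' n, (x n) ^ 2)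

/-- The Kalton–Peck map, defined coordinatewise.  (In Lean, `Real.log 0 = 0` and
division by zero is zero, so the conventions `0·log 0 = 0` and `KP 0 = 0` hold.) -/
noncomputable def KP (x : RSeq) : RSeq := fun n => 2 * x n * Real.log (|x n| / l2norm x)

/-- Membership in the Kalton–Peck space Z₂. -/
def memZ2 (u : RSeq × RSeq) : Prop := memL2 u.2 ∧ memL2 (u.1 - KP u.2)

/-- The Z₂ quasinorm. -/
noncomputable def Z2norm (u : RSeq × RSeq) : ℝ := l2norm (u.1 - KP u.2) + l2norm u.2

/-- A map on pairs of sequences is bounded on Z₂. -/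
def BoundedOnZ2 (T : RSeq × RSeq → RSeq × RSeq) : Prop :=
  (∀ u, memZ2 u → memZ2 (T u)) ∧ ∃ C : ℝ, ∀ u, memZ2 u → Z2norm (T u) ≤ C * Z2norm u

/-- The matrix operator associated to four linear maps on sequences. -/
def matOp (α β δ γ : RSeq →ₗ[ℝ] RSeq) : RSeq × RSeq → RSeq × RSeq :=
  fun u => (α u.1 + β u.2, δ u.1 + γ u.2)

/-- Membership in the Orlicz space ℓ_f = Dom KP. -/
def memLf (x : RSeq) : Prop := memL2 x ∧ memL2 (KP x)

/-- The ℓ_f quasinorm. -/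
noncomputable def lfNorm (x : RSeq) : ℝ := l2norm (KP x) + l2norm x

/-- Membership in ℓ_f* = Ran KP. -/
def memLfStar (ω : RSeq) : Prop := ∃ x : RSeq, memL2 x ∧ memL2 (ω - KP x)

/-- The ℓ_f* quasinorm. -/
noncomputable def lfStarNorm (ω : RSeq) : ℝ :=
  sInf {r : ℝ | ∃ x : RSeq, memL2 x ∧ memL2 (ω - KP x) ∧ r = l2norm (ω - KP x) + l2norm x}

/-- A bounded map on Z₂ is strictly singular if every linear subspace of Z₂ on which it is
bounded below is finite dimensional. -/
def StrictlySingular (T : RSeq × RSeq → RSeq × RSeq) : Prop :=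
  ∀ V : Submodule ℝ (RSeq × RSeq), (∀ v ∈ V, memZ2 v) →
    (∃ c > 0, ∀ v ∈ V, c * Z2norm v ≤ Z2norm (T v)) → FiniteDimensional ℝ V

/-- A set of sequences is totally bounded (relatively compact) for the ℓ² norm. -/
def l2TotallyBounded (A : Set RSeq) : Prop :=
  ∀ ε > 0, ∃ S : Set RSeq, S.Finite ∧
    ∀ a ∈ A, ∃ s ∈ S, memL2 (a - s) ∧ l2norm (a - s) < ε

/-- A map on Z₂ is compact if the image of the unit ball is totally bounded for the
Z₂ quasinorm. -/
def CompactOnZ2 (T : RSeq × RSeq → RSeq × RSeq) : Prop :=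
  ∀ ε > 0, ∃ S : Set (RSeq × RSeq), S.Finite ∧
    ∀ u, memZ2 u → Z2norm u ≤ 1 → ∃ s ∈ S, memZ2 (T u - s) ∧ Z2norm (T u - s) < ε


/-! ### Basic facts on ℓ² -/

lemma memL2_iff (x : RSeq) : memL2 x ↔ Memℓp x 2 := by
  rw [memℓp_gen_iff (by norm_num)]
  unfold memL2
  apply iff_of_eq
  congr 1
  funext n
  simp

lemma l2norm_eq (x : RSeq) (hx : memL2 x) :
    l2norm x = ‖(⟨x, (memL2_iff x).1 hx⟩ : lp (fun _ : ℕ => ℝ) 2)‖ := by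
  rw [lp.norm_eq_tsum_rpow (by norm_num)]
  unfold l2norm
  rw [Real.sqrt_eq_rpow]
  simp

lemma l2norm_nonneg (x : RSeq) : 0 ≤ l2norm x := Real.sqrt_nonneg _

lemma memL2_add {x y : RSeq} (hx : memL2 x) (hy : memL2 y) : memL2 (x + y) := by
  rw [memL2_iff] at *
  exact hx.add hy

lemma l2norm_add_le {x y : RSeq} (hx : memL2 x) (hy : memL2 y) :
    l2norm (x + y) ≤ l2norm x + l2norm y := by
  rw [l2norm_eq x hx, l2norm_eq y hy, l2norm_eq _ (memL2_add hx hy)]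
  exact norm_add_le (⟨x, (memL2_iff x).1 hx⟩ : lp (fun _ : ℕ => ℝ) 2) ⟨y, (memL2_iff y).1 hy⟩

lemma memL2_smul (c : ℝ) {x : RSeq} (hx : memL2 x) : memL2 (c • x) := by
  unfold memL2 at *
  simp only [Pi.smul_apply, smul_eq_mul, mul_pow]
  exact hx.mul_left _

lemma l2norm_smul (c : ℝ) (x : RSeq) : l2norm (c • x) = |c| * l2norm x := by
  unfold l2norm
  simp only [Pi.smul_apply, smul_eq_mul, mul_pow]
  rw [tsum_mul_left, Real.sqrt_mul (sq_nonneg c), Real.sqrt_sq_eq_abs]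

lemma memL2_neg {x : RSeq} (hx : memL2 x) : memL2 (-x) := by
  have := memL2_smul (-1) hx
  simpa using this

lemma l2norm_neg (x : RSeq) : l2norm (-x) = l2norm x := by
  have := l2norm_smul (-1) x
  simpa using this

lemma memL2_sub {x y : RSeq} (hx : memL2 x) (hy : memL2 y) : memL2 (x - y) := by
  rw [sub_eq_add_neg]; exact memL2_add hx (memL2_neg hy)

lemma l2norm_sub_le {x y : RSeq} (hx : memL2 x) (hy : memL2 y) :
    l2norm (x - y) ≤ l2norm x + l2norm y := by
  rw [sub_eq_add_neg]
  simpa [l2norm_neg] using l2norm_add_le hx (memL2_neg hy)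

lemma memL2_zero : memL2 (0 : RSeq) := by
  unfold memL2; simpa using summable_zero

@[simp] lemma l2norm_zero : l2norm (0 : RSeq) = 0 := by
  unfold l2norm; simp

lemma l2norm_sq (x : RSeq) : l2norm x ^ 2 = ∑' n, (x n) ^ 2 := by
  unfold l2norm
  rw [Real.sq_sqrt (tsum_nonneg fun n => sq_nonneg _)]

lemma abs_le_l2norm {x : RSeq} (hx : memL2 x) (j : ℕ) : |x j| ≤ l2norm x := by
  unfold l2norm
  apply Real.abs_le_sqrt
  exact hx.le_tsum j (fun i _ => sq_nonneg _)

lemma memL2_mono {x y : RSeq} (hy : memL2 y) (h : ∀ j, |x j| ≤ |y j|) : memL2 x :=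
  Summable.of_nonneg_of_le (fun _ => sq_nonneg _) (fun j => sq_le_sq.2 (h j)) hy

lemma l2norm_mono {x y : RSeq} (hy : memL2 y) (h : ∀ j, |x j| ≤ |y j|) :
    l2norm x ≤ l2norm y := by
  unfold l2norm
  apply Real.sqrt_le_sqrt
  exact Summable.tsum_le_tsum (fun j => sq_le_sq.2 (h j)) (memL2_mono hy h) hy

lemma memL2_abs {x : RSeq} (hx : memL2 x) : memL2 (fun j => |x j|) :=
  memL2_mono hx (fun j => by simp)

lemma l2norm_abs (x : RSeq) : l2norm (fun j => |x j|) = l2norm x := by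
  unfold l2norm; simp

lemma l2norm_pos {x : RSeq} (hx : memL2 x) {j : ℕ} (hj : x j ≠ 0) : 0 < l2norm x :=
  lt_of_lt_of_le (abs_pos.2 hj) (abs_le_l2norm hx j)

/-! ### Scalar estimates -/

lemma sqrt_mul_log_le {r X : ℝ} (hr : 0 ≤ r) (hX : r ≤ X) :
    r * |Real.log (r / X)| ≤ 2 * √(r * X) := by
  rcases hr.eq_or_lt with rfl | hr
  · simp
  have hX0 : 0 < X := hr.trans_le hX
  set t := √(r / X) with ht
  have htpos : 0 < t := Real.sqrt_pos.2 (div_pos hr hX0)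
  have ht1 : t ≤ 1 := by
    rw [ht]; apply Real.sqrt_le_one.2; exact (div_le_one hX0).2 hX
  have h1 := Real.abs_log_mul_self_lt t htpos ht1
  have hlog : Real.log (r / X) = 2 * Real.log t := by
    rw [ht, Real.log_sqrt (div_pos hr hX0).le]; ring
  have hr' : r = t * √(r * X) := by
    rw [ht, ← Real.sqrt_mul (div_pos hr hX0).le]
    rw [show r / X * (r * X) = r ^ 2 by field_simp]
    rw [Real.sqrt_sq hr.le]
  have hs := Real.sqrt_nonneg (r * X)
  rw [hlog, abs_mul, abs_two]
  rw [abs_mul, abs_of_pos htpos] at h1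
  calc r * (2 * |Real.log t|) = (2 * √(r * X)) * (|Real.log t| * t) := by
        nth_rewrite 1 [hr']; ring
    _ ≤ (2 * √(r * X)) * 1 := by
        apply mul_le_mul_of_nonneg_left h1.le; positivity
    _ = _ := by ring

lemma mul_log_le {r X : ℝ} (hr : 0 ≤ r) (hX : r ≤ X) : r * |Real.log (r / X)| ≤ X := by
  rcases hr.eq_or_lt with rfl | hr
  · simpa using hX
  have hX0 : 0 < X := hr.trans_le hX
  have h1 := Real.abs_log_mul_self_lt (r / X) (div_pos hr hX0) ((div_le_one hX0).2 hX)
  rw [abs_mul, abs_of_pos (div_pos hr hX0)] at h1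
  calc r * |Real.log (r / X)| = X * (|Real.log (r / X)| * (r / X)) := by field_simp
    _ ≤ X * 1 := by apply mul_le_mul_of_nonneg_left h1.le hX0.le
    _ = X := mul_one X

/-! ### Kalton–Peck map -/

@[simp] lemma KP_zero : KP 0 = 0 := by
  funext n; simp [KP]

lemma KP_smul (c : ℝ) (x : RSeq) : KP (c • x) = c • KP x := by
  funext n
  simp only [KP, l2norm_smul, Pi.smul_apply, smul_eq_mul, abs_mul]
  rcases eq_or_ne c 0 with rfl | hc
  · simp
  rw [mul_div_mul_left _ _ (abs_pos.2 hc).ne']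
  ring

lemma abs_KP_le {x : RSeq} (hx : memL2 x) (j : ℕ) : |KP x j| ≤ 4 * √(|x j| * l2norm x) := by
  have := sqrt_mul_log_le (abs_nonneg (x j)) (abs_le_l2norm hx j)
  simp only [KP, abs_mul, abs_two]
  linarith

lemma abs_KP_le' {x : RSeq} (hx : memL2 x) (j : ℕ) : |KP x j| ≤ 2 * l2norm x := by
  have := mul_log_le (abs_nonneg (x j)) (abs_le_l2norm hx j)
  simp only [KP, abs_mul, abs_two]
  linarith

/-- Change of scale in one coordinate. -/
lemma scale_log {s X L : ℝ} (h : s ≠ 0 → 0 < X) (hL : s ≠ 0 → 0 < L) :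
    s * Real.log (|s| / X) = s * Real.log (|s| / L) - s * Real.log (X / L) := by
  rcases eq_or_ne s 0 with rfl | hs
  · simp
  have h1 := h hs
  have h2 := hL hs
  rw [Real.log_div (abs_pos.2 hs).ne' h1.ne', Real.log_div (abs_pos.2 hs).ne' h2.ne',
    Real.log_div h1.ne' h2.ne']
  ring

lemma theta_add (s t L : ℝ) (hL : 0 < L) :
    |(s + t) * Real.log (|s + t| / L) - s * Real.log (|s| / L) - t * Real.log (|t| / L)|
      ≤ 3 * (|s| + |t|) := by
  rcases (add_nonneg (abs_nonneg s) (abs_nonneg t)).eq_or_lt with h0 | hl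
  · have hs : s = 0 := by
      have := abs_nonneg s; have := abs_nonneg t
      exact abs_eq_zero.1 (by linarith)
    have ht : t = 0 := by
      have := abs_nonneg s; have := abs_nonneg t
      exact abs_eq_zero.1 (by linarith)
    subst hs; subst ht; simp
  set l := |s| + |t| with hldef
  have e1 := scale_log (s := s + t) (X := L) (L := l) (fun _ => hL) (fun _ => hl)
  have e2 := scale_log (s := s) (X := L) (L := l) (fun _ => hL) (fun _ => hl)
  have e3 := scale_log (s := t) (X := L) (L := l) (fun _ => hL) (fun _ => hl)
  have b1 := mul_log_le (abs_nonneg (s + t)) (abs_add_le s t)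
  have b2 := mul_log_le (abs_nonneg s) (show |s| ≤ l by have := abs_nonneg t; linarith)
  have b3 := mul_log_le (abs_nonneg t) (show |t| ≤ l by have := abs_nonneg s; linarith)
  rw [← hldef] at b1
  have : (s + t) * Real.log (|s + t| / L) - s * Real.log (|s| / L) - t * Real.log (|t| / L)
      = (s + t) * Real.log (|s + t| / l) - s * Real.log (|s| / l) - t * Real.log (|t| / l) := by
    rw [e1, e2, e3]; ring
  rw [this]
  have t1 := abs_sub ((s + t) * Real.log (|s + t| / l) - s * Real.log (|s| / l))
    (t * Real.log (|t| / l))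
  have t2 := abs_sub ((s + t) * Real.log (|s + t| / l)) (s * Real.log (|s| / l))
  rw [abs_mul] at t1
  rw [abs_mul, abs_mul] at t2
  linarith

lemma KP_add {x y : RSeq} (hx : memL2 x) (hy : memL2 y) :
    memL2 (KP (x + y) - KP x - KP y) ∧
      l2norm (KP (x + y) - KP x - KP y) ≤ 12 * (l2norm x + l2norm y) := by
  set X := l2norm x with hX
  set Y := l2norm y with hY
  set W := l2norm (x + y) with hW
  have hXn : 0 ≤ X := l2norm_nonneg x
  have hYn : 0 ≤ Y := l2norm_nonneg y
  have hWn : 0 ≤ W := l2norm_nonneg (x + y)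
  have hxy := memL2_add hx hy
  have hWL : W ≤ X + Y := l2norm_add_le hx hy
  set L := X + Y with hL
  set A : RSeq := fun j => 2 * ((x j + y j) * Real.log (|x j + y j| / L)
      - x j * Real.log (|x j| / L) - y j * Real.log (|y j| / L)) with hA
  have hdecomp : KP (x + y) - KP x - KP y =
      A - ((2 * Real.log (W / L)) • (x + y) - (2 * Real.log (X / L)) • x
        - (2 * Real.log (Y / L)) • y) := by
    funext j
    have e1 := scale_log (s := x j + y j) (X := W) (L := L)
      (fun h => l2norm_pos hxy (j := j) h) (fun h => (l2norm_pos hxy (j := j) h).trans_le hWL)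
    have e2 := scale_log (s := x j) (X := X) (L := L)
      (fun h => l2norm_pos hx (j := j) h)
      (fun h => (l2norm_pos hx (j := j) h).trans_le (by linarith))
    have e3 := scale_log (s := y j) (X := Y) (L := L)
      (fun h => l2norm_pos hy (j := j) h)
      (fun h => (l2norm_pos hy (j := j) h).trans_le (by linarith))
    simp only [KP, Pi.sub_apply, Pi.add_apply, Pi.smul_apply, smul_eq_mul, hA, ← hX, ← hY, ← hW]
    linear_combination 2 * e1 - 2 * e2 - 2 * e3
  have hG : memL2 ((6 : ℝ) • ((fun j => |x j|) + (fun j => |y j|) : RSeq)) :=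
    memL2_smul _ (memL2_add (memL2_abs hx) (memL2_abs hy))
  have hAG : ∀ j, |A j| ≤ |((6 : ℝ) • ((fun j => |x j|) + (fun j => |y j|) : RSeq)) j| := by
    intro j
    simp only [Pi.smul_apply, Pi.add_apply, smul_eq_mul]
    rw [abs_of_nonneg (by positivity : (0:ℝ) ≤ 6 * (|x j| + |y j|))]
    rcases (add_nonneg hXn hYn).eq_or_lt with h0 | hl
    · have : A j = 0 := by simp [hA, hL, ← h0]
      rw [this]; simp; positivity
    · have := theta_add (x j) (y j) L hl
      simp only [hA, abs_mul, abs_two]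
      linarith
  have hAm := memL2_mono hG hAG
  have hAn := l2norm_mono hG hAG
  have hG2 : l2norm ((6 : ℝ) • ((fun j => |x j|) + (fun j => |y j|) : RSeq)) ≤ 6 * L := by
    rw [l2norm_smul]
    have := l2norm_add_le (memL2_abs hx) (memL2_abs hy)
    rw [l2norm_abs, l2norm_abs] at this
    norm_num
    exact this
  have m1 := memL2_smul (2 * Real.log (W / L)) hxy
  have m2 := memL2_smul (2 * Real.log (X / L)) hx
  have m3 := memL2_smul (2 * Real.log (Y / L)) hy
  have n1 : l2norm ((2 * Real.log (W / L)) • (x + y)) ≤ 2 * L := by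
    rw [l2norm_smul, abs_mul, abs_two]
    have := mul_log_le hWn hWL
    linarith
  have n2 : l2norm ((2 * Real.log (X / L)) • x) ≤ 2 * L := by
    rw [l2norm_smul, abs_mul, abs_two]
    have := mul_log_le hXn (show X ≤ L by linarith)
    linarith
  have n3 : l2norm ((2 * Real.log (Y / L)) • y) ≤ 2 * L := by
    rw [l2norm_smul, abs_mul, abs_two]
    have := mul_log_le hYn (show Y ≤ L by linarith)
    linarith
  rw [hdecomp]
  refine ⟨memL2_sub hAm (memL2_sub (memL2_sub m1 m2) m3), ?_⟩
  have q1 := l2norm_sub_le hAm (memL2_sub (memL2_sub m1 m2) m3)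
  have q2 := l2norm_sub_le (memL2_sub m1 m2) m3
  have q3 := l2norm_sub_le m1 m2
  linarith

/-! ### The quasinorm -/

lemma Z2norm_nonneg (u : RSeq × RSeq) : 0 ≤ Z2norm u :=
  add_nonneg (l2norm_nonneg _) (l2norm_nonneg _)

lemma Z2_add {u v : RSeq × RSeq} (hu : memZ2 u) (hv : memZ2 v) :
    memZ2 (u + v) ∧ Z2norm (u + v) ≤ 13 * (Z2norm u + Z2norm v) := by
  obtain ⟨hm, hn⟩ := KP_add hu.1 hv.1
  have e : (u + v).1 - KP (u + v).2 =
      ((u.1 - KP u.2) + (v.1 - KP v.2)) - (KP (u.2 + v.2) - KP u.2 - KP v.2) := by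
    simp only [Prod.fst_add, Prod.snd_add]; abel
  have h12 := memL2_add hu.2 hv.2
  refine ⟨⟨memL2_add hu.1 hv.1, ?_⟩, ?_⟩
  · rw [e]; exact memL2_sub h12 hm
  · unfold Z2norm
    rw [e]
    have q1 := l2norm_sub_le h12 hm
    have q2 := l2norm_add_le hu.2 hv.2
    have q3 := l2norm_add_le hu.1 hv.1
    have := l2norm_nonneg (u.1 - KP u.2)
    have := l2norm_nonneg (v.1 - KP v.2)
    simp only [Prod.snd_add]
    linarith

lemma Z2_smul (c : ℝ) {u : RSeq × RSeq} (hu : memZ2 u) : memZ2 (c • u) := by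
  refine ⟨memL2_smul c hu.1, ?_⟩
  simp only [Prod.smul_fst, Prod.smul_snd, KP_smul, ← smul_sub]
  exact memL2_smul c hu.2

lemma Z2norm_smul (c : ℝ) (u : RSeq × RSeq) : Z2norm (c • u) = |c| * Z2norm u := by
  unfold Z2norm
  simp only [Prod.smul_fst, Prod.smul_snd, KP_smul, ← smul_sub, l2norm_smul]
  ring

lemma memZ2_zero : memZ2 0 := by
  refine ⟨memL2_zero, ?_⟩
  simpa using memL2_zero

@[simp] lemma Z2norm_zero : Z2norm 0 = 0 := by simp [Z2norm]

lemma Z2_neg {u : RSeq × RSeq} (hu : memZ2 u) : memZ2 (-u) := by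
  simpa using Z2_smul (-1) hu

lemma Z2norm_neg (u : RSeq × RSeq) : Z2norm (-u) = Z2norm u := by
  simpa using Z2norm_smul (-1) u

lemma Z2_sub {u v : RSeq × RSeq} (hu : memZ2 u) (hv : memZ2 v) :
    memZ2 (u - v) ∧ Z2norm (u - v) ≤ 13 * (Z2norm u + Z2norm v) := by
  have := Z2_add hu (Z2_neg hv)
  rwa [Z2norm_neg, ← sub_eq_add_neg] at this

def Z2sub : Submodule ℝ (RSeq × RSeq) where
  carrier := {u | memZ2 u}
  add_mem' := fun hu hv => (Z2_add hu hv).1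
  zero_mem' := memZ2_zero
  smul_mem' := fun c _ hu => Z2_smul c hu

lemma l2norm_snd_le (u : RSeq × RSeq) : l2norm u.2 ≤ Z2norm u := by
  unfold Z2norm
  have := l2norm_nonneg (u.1 - KP u.2)
  linarith

lemma l2norm_y_le (u : RSeq × RSeq) : l2norm (u.1 - KP u.2) ≤ Z2norm u := by
  unfold Z2norm
  have := l2norm_nonneg (u.2)
  linarith

lemma abs_snd_le {u : RSeq × RSeq} (hu : memZ2 u) (j : ℕ) : |u.2 j| ≤ Z2norm u :=
  (abs_le_l2norm hu.1 j).trans (l2norm_snd_le u)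

lemma abs_fst_le {u : RSeq × RSeq} (hu : memZ2 u) (j : ℕ) : |u.1 j| ≤ 2 * Z2norm u := by
  have h1 := abs_le_l2norm hu.2 j
  have h2 := abs_KP_le' hu.1 j
  have h3 : |u.1 j| ≤ |(u.1 - KP u.2) j| + |KP u.2 j| := by
    have := abs_add_le ((u.1 - KP u.2) j) (KP u.2 j)
    simpa using this
  unfold Z2norm
  have := l2norm_nonneg (u.1 - KP u.2)
  linarith

lemma Z2_pair_zero {y : RSeq} (hy : memL2 y) :
    memZ2 (y, 0) ∧ Z2norm (y, 0) = l2norm y := by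
  refine ⟨⟨memL2_zero, by simpa using hy⟩, by simp [Z2norm]⟩

lemma Z2_KP {x : RSeq} (hx : memL2 x) :
    memZ2 (KP x, x) ∧ Z2norm (KP x, x) = l2norm x := by
  refine ⟨⟨hx, by simpa using memL2_zero⟩, by simp [Z2norm]⟩

lemma Z2_split {u : RSeq × RSeq} :
    u = (u.1 - KP u.2, 0) + (KP u.2, u.2) := by
  ext <;> simp

/-! ### Gliding hump selection -/

lemma tail_split (G : ℕ → ℝ) (hG0 : ∀ j, 0 ≤ G j) (hGs : Summable G) {n₁ n₂ k : ℕ} (hn : n₁ ≤ n₂)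
    {κ : ℕ → ℕ} (hκ : ∀ j, n₁ ≤ j → j < n₂ → κ j = k) {ε : ℝ}
    (b1 : ∑ j ∈ Finset.range n₁, G j ≤ ε / 2) (b2 : ∑' j, G (j + n₂) ≤ ε / 2) :
    ∑' j, (if κ j = k then 0 else G j) ≤ ε := by
  have hsum : Summable (fun j => if κ j = k then 0 else G j) := by
    refine Summable.of_nonneg_of_le (fun j => ?_) (fun j => ?_) hGs
    · split_ifs; exacts [le_rfl, hG0 _]
    · split_ifs; exacts [hG0 _, le_rfl]
  have hle : ∀ j, (if κ j = k then 0 else G j) ≤ G j := by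
    intro j; split_ifs; exacts [hG0 _, le_rfl]
  rw [← hsum.sum_add_tsum_nat_add n₂]
  have c2 : ∑' j, (if κ (j + n₂) = k then 0 else G (j + n₂)) ≤ ε / 2 := by
    refine le_trans (Summable.tsum_le_tsum (fun j => hle _) ?_ ?_) b2
    · exact (summable_nat_add_iff n₂).2 hsum
    · exact (summable_nat_add_iff n₂).2 hGs
  have c1 : ∑ j ∈ Finset.range n₂, (if κ j = k then 0 else G j) ≤ ε / 2 := by
    refine le_trans ?_ b1
    have hsub : Finset.range n₁ ⊆ Finset.range n₂ :=
      Finset.range_subset_range.2 hn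
    rw [← Finset.sum_subset hsub]
    · exact Finset.sum_le_sum (fun j _ => hle j)
    · intro j hj1 hj2
      rw [Finset.mem_range] at hj1
      rw [Finset.mem_range, not_lt] at hj2
      rw [if_pos (hκ j hj2 hj1)]
  linarith

lemma select_blocks (F : ℕ → ℕ → ℝ) (hF0 : ∀ k j, 0 ≤ F k j) (hFs : ∀ k, Summable (F k))
    (hF : ∀ j, Filter.Tendsto (fun k => F k j) Filter.atTop (nhds 0))
    (ε : ℕ → ℝ) (hε : ∀ k, 0 < ε k) :
    ∃ φ : ℕ → ℕ, StrictMono φ ∧ ∃ κ : ℕ → ℕ, ∀ k,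
      ∑' j, (if κ j = k then 0 else F (φ k) j) ≤ ε k := by
  have step : ∀ (k : ℕ) (p : ℕ × ℕ), ∃ q : ℕ × ℕ, p.1 < q.1 ∧ p.2 ≤ q.2 ∧
      ∑ j ∈ Finset.range p.2, F q.1 j ≤ ε k / 2 ∧
      ∑' j, F q.1 (j + q.2) ≤ ε k / 2 := by
    intro k p
    have h1 : Filter.Tendsto (fun m => ∑ j ∈ Finset.range p.2, F m j) Filter.atTop (nhds 0) := by
      have := tendsto_finsetSum (Finset.range p.2) (fun j _ => hF j)
      simpa using this
    have h2 := (h1.eventually (ge_mem_nhds (half_pos (hε k)))).and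
      (Filter.eventually_gt_atTop p.1)
    obtain ⟨m, hm1, hm2⟩ := h2.exists
    have h3 := tendsto_sum_nat_add (F m)
    have h4 := (h3.eventually (ge_mem_nhds (half_pos (hε k)))).and
      (Filter.eventually_ge_atTop p.2)
    obtain ⟨n, hn1, hn2⟩ := h4.exists
    exact ⟨(m, n), hm2, hn2, hm1, hn1⟩
  choose f hf1 hf2 hf3 hf4 using step
  let s : ℕ → ℕ × ℕ := fun k => Nat.rec (0, 0) (fun k p => f k p) k
  have hs : ∀ k, s (k + 1) = f k (s k) := fun k => rfl
  let n : ℕ → ℕ := fun k => (s k).2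
  have hn : Monotone n := monotone_nat_of_le_succ (fun k => by
    change (s k).2 ≤ (s (k + 1)).2
    rw [hs]; exact hf2 _ _)
  classical
  let κ : ℕ → ℕ := fun j => if h : ∃ k, n k ≤ j ∧ j < n (k + 1) then h.choose else 0
  have hκ : ∀ j k, n k ≤ j → j < n (k + 1) → κ j = k := by
    intro j k h1 h2
    have h : ∃ k, n k ≤ j ∧ j < n (k + 1) := ⟨k, h1, h2⟩
    have hd : κ j = h.choose := dif_pos h
    obtain ⟨h3, h4⟩ := h.choose_spec
    rw [hd]
    by_contra hne
    rcases lt_or_gt_of_ne hne with hlt | hlt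
    · have := hn (Nat.succ_le_of_lt hlt)
      simp only [Nat.succ_eq_add_one] at this
      omega
    · have := hn (Nat.succ_le_of_lt hlt)
      simp only [Nat.succ_eq_add_one] at this
      omega
  refine ⟨fun k => (s (k + 1)).1, strictMono_nat_of_lt_succ (fun k => ?_), κ, fun k => ?_⟩
  · rw [hs (k + 1)]; exact hf1 _ _
  · set m := (s (k + 1)).1 with hm
    have b1 : ∑ j ∈ Finset.range (n k), F m j ≤ ε k / 2 := by
      have := hf3 k (s k); rw [← hs] at this; exact this
    have b2 : ∑' j, F m (j + n (k + 1)) ≤ ε k / 2 := by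
      have := hf4 k (s k); rw [← hs] at this; exact this
    exact tail_split (F m) (hF0 m) (hFs m) (hn (Nat.le_succ k)) (fun j => hκ j k) b1 b2

/-! ### Restrictions -/

open Classical in
/-- Restriction of a sequence to a set of coordinates. -/
def restr (A : Set ℕ) (x : RSeq) : RSeq := fun j => if j ∈ A then x j else 0

/-- Restriction of a pair. -/
def restrZ (A : Set ℕ) (u : RSeq × RSeq) : RSeq × RSeq := (restr A u.1, restr A u.2)

lemma restr_le (A : Set ℕ) (x : RSeq) (j : ℕ) : |restr A x j| ≤ |x j| := by
  unfold restr; split_ifs <;> simp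

lemma memL2_restr (A : Set ℕ) {x : RSeq} (hx : memL2 x) : memL2 (restr A x) :=
  memL2_mono hx (restr_le A x)

lemma l2norm_restr_le (A : Set ℕ) {x : RSeq} (hx : memL2 x) : l2norm (restr A x) ≤ l2norm x :=
  l2norm_mono hx (restr_le A x)

lemma restrZ_add_compl (A : Set ℕ) (u : RSeq × RSeq) : restrZ A u + restrZ Aᶜ u = u := by
  ext j <;> by_cases h : j ∈ A <;> simp [restrZ, restr, h]

lemma restrZ_mem (A : Set ℕ) {u : RSeq × RSeq} (hu : memZ2 u) :
    memZ2 (restrZ A u) ∧ Z2norm (restrZ A u) ≤ l2norm (restr A (u.1 - KP u.2)) +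
      4 * √(l2norm (restr A u.2) * l2norm u.2) + l2norm (restr A u.2) := by
  set R := l2norm (restr A u.2) with hR
  set X := l2norm u.2 with hX
  have hx := hu.1
  have hrx := memL2_restr A hu.1
  have hry := memL2_restr A hu.2
  have e : (restrZ A u).1 - KP (restrZ A u).2 =
      restr A (u.1 - KP u.2) + (2 * Real.log (R / X)) • restr A u.2 := by
    funext j
    by_cases h : j ∈ A
    · have hr : restr A u.2 j = u.2 j := by simp [restr, h]
      have e1 := scale_log (s := u.2 j) (X := R) (L := X)
        (fun h => l2norm_pos hrx (j := j) (by rw [hr]; exact h))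
        (fun h => l2norm_pos hx (j := j) h)
      simp only [restrZ, Pi.sub_apply, Pi.add_apply, Pi.smul_apply, smul_eq_mul, KP, ← hR, hr]
      simp only [restr, h, if_true, Pi.sub_apply, KP, ← hX]
      linear_combination -2 * e1
    · simp [restrZ, restr, h, KP]
  have m2 := memL2_smul (2 * Real.log (R / X)) hrx
  refine ⟨⟨hrx, ?_⟩, ?_⟩
  · rw [e]; exact memL2_add hry m2
  · unfold Z2norm
    rw [e]
    have q1 := l2norm_add_le hry m2
    have q2 := l2norm_smul (2 * Real.log (R / X)) (restr A u.2)
    rw [abs_mul, abs_two, ← hR] at q2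
    have q3 := sqrt_mul_log_le (l2norm_nonneg _) (l2norm_restr_le A hu.1)
    rw [← hR, ← hX] at q3
    have : l2norm (restrZ A u).2 = R := rfl
    linarith

lemma Z2y_tendsto {v : ℕ → RSeq × RSeq} (hm : ∀ k, memZ2 (v k)) {M : ℝ}
    (hM : ∀ k, Z2norm (v k) ≤ M) (h0 : Filter.Tendsto v Filter.atTop (nhds 0)) (j : ℕ) :
    Filter.Tendsto (fun k => ((v k).1 - KP (v k).2) j) Filter.atTop (nhds 0) ∧
    Filter.Tendsto (fun k => (v k).2 j) Filter.atTop (nhds 0) := by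
  have h1 : Filter.Tendsto (fun k => (v k).1 j) Filter.atTop (nhds 0) :=
    (tendsto_pi_nhds.1 ((continuous_fst.tendsto _).comp h0)) j
  have h2 : Filter.Tendsto (fun k => (v k).2 j) Filter.atTop (nhds 0) :=
    (tendsto_pi_nhds.1 ((continuous_snd.tendsto _).comp h0)) j
  refine ⟨?_, h2⟩
  have hK : Filter.Tendsto (fun k => KP (v k).2 j) Filter.atTop (nhds 0) := by
    apply squeeze_zero_norm (a := fun k => 4 * √(|(v k).2 j| * M))
    · intro k
      refine (abs_KP_le (hm k).1 j).trans ?_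
      have := (l2norm_snd_le (v k)).trans (hM k)
      gcongr
    · have h3 : Filter.Tendsto (fun k => |(v k).2 j| * M) Filter.atTop (nhds 0) := by
        have := (h2.abs).mul_const M
        simpa using this
      have h4 := (Real.continuous_sqrt.tendsto 0).comp h3
      have h5 := h4.const_mul 4
      simpa using h5
  simpa using h1.sub hK

lemma block_lemma {v : ℕ → RSeq × RSeq} (hm : ∀ k, memZ2 (v k)) {M : ℝ}
    (hM : ∀ k, Z2norm (v k) ≤ M) (h0 : Filter.Tendsto v Filter.atTop (nhds 0))
    (e : ℕ → ℝ) (he : ∀ k, 0 < e k) :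
    ∃ φ : ℕ → ℕ, StrictMono φ ∧ ∃ κ : ℕ → ℕ, ∀ k,
      Z2norm (restrZ {j | κ j = k}ᶜ (v (φ k))) ≤ e k := by
  have hM0 : 0 ≤ M := (Z2norm_nonneg _).trans (hM 0)
  let s : ℕ → ℝ := fun k => min (e k / 4) ((e k) ^ 2 / (64 * (M + 1)))
  have hs : ∀ k, 0 < s k := fun k => by
    have := he k
    apply lt_min <;> positivity
  let F : ℕ → ℕ → ℝ := fun k j => ((v k).1 - KP (v k).2) j ^ 2 + (v k).2 j ^ 2
  have hF0 : ∀ k j, 0 ≤ F k j := fun k j => by positivity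
  obtain ⟨φ, hφ, κ, hκ⟩ := select_blocks F hF0 (fun k => (hm k).2.add (hm k).1)
    (fun j => by
      obtain ⟨h1, h2⟩ := Z2y_tendsto hm hM h0 j
      have := (h1.pow 2).add (h2.pow 2)
      simpa [F] using this) (fun k => s k ^ 2) (fun k => by have := hs k; positivity)
  refine ⟨φ, hφ, κ, fun k => ?_⟩
  set A := {j | κ j = k}ᶜ with hA
  set u := v (φ k) with hu
  have hsum : Summable (fun j => if κ j = k then 0 else F (φ k) j) := by
    refine Summable.of_nonneg_of_le (fun j => ?_) (fun j => ?_) ((hm (φ k)).2.add (hm (φ k)).1)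
    · split_ifs; exacts [le_rfl, hF0 _ _]
    · split_ifs; exacts [hF0 _ _, le_rfl]
  have n1 : l2norm (restr A (u.1 - KP u.2)) ≤ s k := by
    apply Real.sqrt_le_iff.2 ⟨(hs k).le, le_trans (Summable.tsum_le_tsum ?_ ?_ hsum) (hκ k)⟩
    · intro j
      by_cases h : κ j = k
      · simp [restr, hA, h]
      · simp only [restr, hA, h, if_false, Set.mem_compl_iff, Set.mem_ofPred_eq, not_false_eq_true,
          if_true]
        exact le_add_of_nonneg_right (sq_nonneg _)
    · exact memL2_restr A (hm (φ k)).2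
  have n2 : l2norm (restr A u.2) ≤ s k := by
    apply Real.sqrt_le_iff.2 ⟨(hs k).le, le_trans (Summable.tsum_le_tsum ?_ ?_ hsum) (hκ k)⟩
    · intro j
      by_cases h : κ j = k
      · simp [restr, hA, h]
      · simp only [restr, hA, h, if_false, Set.mem_compl_iff, Set.mem_ofPred_eq, not_false_eq_true,
          if_true]
        exact le_add_of_nonneg_left (sq_nonneg _)
    · exact memL2_restr A (hm (φ k)).1
  have n3 := (restrZ_mem A (hm (φ k))).2
  rw [← hu] at n3
  have n4 : √(l2norm (restr A u.2) * l2norm u.2) ≤ e k / 8 := by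
    apply Real.sqrt_le_iff.2 ⟨by have := he k; positivity, ?_⟩
    have a1 : l2norm u.2 ≤ M := (l2norm_snd_le _).trans (hM _)
    have a2 : s k ≤ (e k) ^ 2 / (64 * (M + 1)) := min_le_right _ _
    calc l2norm (restr A u.2) * l2norm u.2 ≤ (e k) ^ 2 / (64 * (M + 1)) * (M + 1) := by
          apply mul_le_mul (n2.trans a2) (by linarith) (l2norm_nonneg _) (by positivity)
      _ = (e k / 8) ^ 2 := by field_simp; norm_num
  have a3 : s k ≤ e k / 4 := min_le_left _ _
  linarith

/-! ### Disjointly supported combinations -/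

lemma lc_apply_disj {f : ℕ → RSeq} {κ : ℕ → ℕ} (hf : ∀ k j, κ j ≠ k → f k j = 0)
    (a : ℕ →₀ ℝ) (j : ℕ) :
    (Finsupp.linearCombination ℝ f a) j = a (κ j) * f (κ j) j := by
  rw [Finsupp.linearCombination_apply, Finsupp.sum, Finset.sum_apply]
  rw [Finset.sum_eq_single (κ j)]
  · simp
  · intro b _ hb
    simp [hf b j hb.symm]
  · intro h
    simp [Finsupp.notMem_support_iff.1 h]

lemma memL2_lc {f : ℕ → RSeq} (hm : ∀ k, memL2 (f k)) (a : ℕ →₀ ℝ) :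
    memL2 (Finsupp.linearCombination ℝ f a) := by
  rw [Finsupp.linearCombination_apply, Finsupp.sum]
  refine Finset.sum_induction _ memL2 (fun _ _ => memL2_add) memL2_zero ?_
  intro k _
  exact memL2_smul _ (hm k)

lemma memL2_finsupp (a : ℕ →₀ ℝ) : memL2 a := by
  apply summable_of_ne_finset_zero (s := a.support)
  intro b hb
  simp [Finsupp.notMem_support_iff.1 hb]

lemma l2norm_lc_disj {f : ℕ → RSeq} {κ : ℕ → ℕ} (hf : ∀ k j, κ j ≠ k → f k j = 0)
    (hm : ∀ k, memL2 (f k)) (a : ℕ →₀ ℝ) :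
    l2norm (Finsupp.linearCombination ℝ f a) = l2norm (fun k => a k * l2norm (f k)) := by
  unfold l2norm
  congr 1
  have e1 : ∀ j, (Finsupp.linearCombination ℝ f a) j ^ 2 =
      ∑ k ∈ a.support, (a k) ^ 2 * (f k j) ^ 2 := by
    intro j
    rw [lc_apply_disj hf, mul_pow, Finset.sum_eq_single (κ j)]
    · intro b _ hb
      simp [hf b j hb.symm]
    · intro h
      simp [Finsupp.notMem_support_iff.1 h]
  simp_rw [e1]
  rw [Summable.tsum_finsetSum (fun k _ => (hm k).mul_left _)]
  rw [tsum_eq_sum (s := a.support)]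
  · apply Finset.sum_congr rfl
    intro k _
    rw [tsum_mul_left, mul_pow]
    congr 1
    exact (l2norm_sq (f k)).symm
  · intro b hb
    simp [Finsupp.notMem_support_iff.1 hb]

lemma l2norm_mul_le {a t : RSeq} (ha : memL2 a) {M : ℝ} (ht : ∀ k, |t k| ≤ M) :
    l2norm (fun k => a k * t k) ≤ M * l2norm a := by
  have hM : 0 ≤ M := (abs_nonneg _).trans (ht 0)
  have := l2norm_mono (x := fun k => a k * t k) (memL2_smul M ha) (fun j => by
    simp only [Pi.smul_apply, smul_eq_mul, abs_mul, abs_of_nonneg hM]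
    rw [mul_comm]
    gcongr
    exact ht j)
  rwa [l2norm_smul, abs_of_nonneg hM] at this

lemma le_l2norm_mul {a t : RSeq} (ha : memL2 (fun k => a k * t k)) {δ : ℝ} (hδ : 0 ≤ δ)
    (ht : ∀ k, δ ≤ t k) :
    δ * l2norm a ≤ l2norm (fun k => a k * t k) := by
  have := l2norm_mono (x := δ • a) ha (fun j => by
    simp only [Pi.smul_apply, smul_eq_mul, abs_mul, abs_of_nonneg hδ]
    rw [mul_comm]
    gcongr
    exact (ht j).trans (le_abs_self _))
  rwa [l2norm_smul, abs_of_nonneg hδ] at this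

/-! ### Upper and lower estimates -/

/-- Upper estimate of linear combinations of `v` by `N`. -/
def UpperE (N : RSeq → ℝ) (v : ℕ → RSeq × RSeq) : Prop :=
  ∃ C : ℝ, ∀ a : ℕ →₀ ℝ, Z2norm (Finsupp.linearCombination ℝ v a) ≤ C * N a

/-- Lower estimate of linear combinations of `v` by `N`. -/
def LowerE (N : RSeq → ℝ) (v : ℕ → RSeq × RSeq) : Prop :=
  ∃ K : ℝ, ∀ a : ℕ →₀ ℝ, N a ≤ K * Z2norm (Finsupp.linearCombination ℝ v a)

lemma memZ2_lc {v : ℕ → RSeq × RSeq} (hm : ∀ k, memZ2 (v k)) (a : ℕ →₀ ℝ) :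
    memZ2 (Finsupp.linearCombination ℝ v a) := by
  rw [Finsupp.linearCombination_apply, Finsupp.sum]
  refine Finset.sum_induction _ memZ2 (fun _ _ h1 h2 => (Z2_add h1 h2).1) memZ2_zero ?_
  intro k _
  exact Z2_smul _ (hm k)

lemma Z2_sum_le (n : ℕ) : ∀ f : ℕ → RSeq × RSeq, (∀ k, memZ2 (f k)) →
    memZ2 (∑ k ∈ Finset.range n, f k) ∧
    Z2norm (∑ k ∈ Finset.range n, f k) ≤ ∑ k ∈ Finset.range n, 13 ^ (k + 1) * Z2norm (f k) := by
  induction n with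
  | zero => intro f _; simpa using memZ2_zero
  | succ n ih =>
    intro f hf
    obtain ⟨h1, h2⟩ := ih (fun k => f (k + 1)) (fun k => hf _)
    obtain ⟨h3, h4⟩ := Z2_add h1 (hf 0)
    rw [Finset.sum_range_succ', Finset.sum_range_succ']
    refine ⟨h3, h4.trans ?_⟩
    have : ∑ k ∈ Finset.range n, (13:ℝ) ^ (k + 1 + 1) * Z2norm (f (k + 1)) =
        13 * ∑ k ∈ Finset.range n, 13 ^ (k + 1) * Z2norm (f (k + 1)) := by
      rw [Finset.mul_sum]
      apply Finset.sum_congr rfl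
      intro k _; ring
    rw [this]
    norm_num
    linarith

lemma geom_half (n : ℕ) : ∑ k ∈ Finset.range n, (1 / 2 : ℝ) ^ (k + 1) ≤ 1 := by
  have : ∑ k ∈ Finset.range n, (1 / 2 : ℝ) ^ (k + 1) = 1 - (1 / 2) ^ n := by
    induction n with
    | zero => simp
    | succ n ih => rw [Finset.sum_range_succ, ih]; ring
  rw [this]
  have : (0:ℝ) ≤ (1 / 2) ^ n := by positivity
  linarith

lemma lc_small {p : ℕ → RSeq × RSeq} (hm : ∀ k, memZ2 (p k)) {η : ℝ} (hη : 0 ≤ η)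
    (hp : ∀ k, Z2norm (p k) ≤ η / 26 ^ (k + 1)) (a : ℕ →₀ ℝ) :
    Z2norm (Finsupp.linearCombination ℝ p a) ≤ η * l2norm a := by
  obtain ⟨n, hn⟩ := a.support.exists_nat_subset_range
  rw [Finsupp.linearCombination_apply, Finsupp.sum_of_support_subset a hn _ (by simp)]
  refine (Z2_sum_le n (fun k => a k • p k) (fun k => Z2_smul _ (hm k))).2.trans ?_
  calc ∑ k ∈ Finset.range n, (13:ℝ) ^ (k + 1) * Z2norm (a k • p k)
      ≤ ∑ k ∈ Finset.range n, (η * l2norm a) * (1 / 2 : ℝ) ^ (k + 1) := by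
        apply Finset.sum_le_sum
        intro k _
        rw [Z2norm_smul]
        have h1 := abs_le_l2norm (memL2_finsupp a) k
        have h2 : |a k| * Z2norm (p k) ≤ l2norm a * (η / 26 ^ (k + 1)) :=
          mul_le_mul h1 (hp k) (Z2norm_nonneg _) (l2norm_nonneg _)
        calc (13:ℝ) ^ (k + 1) * (|a k| * Z2norm (p k))
            ≤ 13 ^ (k + 1) * (l2norm a * (η / 26 ^ (k + 1))) := by gcongr
          _ = (η * l2norm a) * (1 / 2 : ℝ) ^ (k + 1) := by
            rw [show (26:ℝ) = 13 * 2 by norm_num, mul_pow, one_div, inv_pow]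
            field_simp
    _ = (η * l2norm a) * ∑ k ∈ Finset.range n, (1 / 2 : ℝ) ^ (k + 1) := by rw [Finset.mul_sum]
    _ ≤ (η * l2norm a) * 1 := by
        apply mul_le_mul_of_nonneg_left (geom_half n)
        exact mul_nonneg hη (l2norm_nonneg _)
    _ = _ := mul_one _

lemma lc_add_fun (w p : ℕ → RSeq × RSeq) (a : ℕ →₀ ℝ) :
    Finsupp.linearCombination ℝ (fun k => w k + p k) a =
      Finsupp.linearCombination ℝ w a + Finsupp.linearCombination ℝ p a := by
  simp only [Finsupp.linearCombination_apply, Finsupp.sum, smul_add, Finset.sum_add_distrib]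

lemma perturb {N : RSeq → ℝ} (hN : ∀ a : ℕ →₀ ℝ, l2norm a ≤ N a)
    {w p : ℕ → RSeq × RSeq} (hw : ∀ k, memZ2 (w k)) (hp : ∀ k, memZ2 (p k))
    {C K η : ℝ} (hη : 0 ≤ η) (hK : 0 < K) (hηK : 26 * K * η ≤ 1)
    (hpn : ∀ k, Z2norm (p k) ≤ η / 26 ^ (k + 1))
    (hU : ∀ a : ℕ →₀ ℝ, Z2norm (Finsupp.linearCombination ℝ w a) ≤ C * N a)
    (hL : ∀ a : ℕ →₀ ℝ, N a ≤ K * Z2norm (Finsupp.linearCombination ℝ w a)) :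
    UpperE N (fun k => w k + p k) ∧ LowerE N (fun k => w k + p k) := by
  refine ⟨⟨13 * (C + η), fun a => ?_⟩, ⟨26 * K, fun a => ?_⟩⟩
  · rw [lc_add_fun]
    have h1 := (Z2_add (memZ2_lc hw a) (memZ2_lc hp a)).2
    have h2 := lc_small hp hη hpn a
    have h3 := hU a
    have h4 : η * l2norm a ≤ η * N a := mul_le_mul_of_nonneg_left (hN a) hη
    linarith
  · have e : Finsupp.linearCombination ℝ w a =
        Finsupp.linearCombination ℝ (fun k => w k + p k) a - Finsupp.linearCombination ℝ p a := by
      rw [lc_add_fun]; abel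
    have hv : ∀ k, memZ2 (w k + p k) := fun k => (Z2_add (hw k) (hp k)).1
    have h1 := (Z2_sub (memZ2_lc hv a) (memZ2_lc hp a)).2
    rw [← e] at h1
    have h2 := lc_small hp hη hpn a
    have h3 := hL a
    have h4 : η * l2norm a ≤ η * N a := mul_le_mul_of_nonneg_left (hN a) hη
    have hNa : 0 ≤ N a := (l2norm_nonneg _).trans (hN a)
    set Zv := Z2norm (Finsupp.linearCombination ℝ (fun k => w k + p k) a)
    have h5 : N a ≤ K * (13 * (Zv + η * N a)) :=
      h3.trans (mul_le_mul_of_nonneg_left (by linarith) hK.le)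
    have h6 : (26 * K * η) * N a ≤ 1 * N a := mul_le_mul_of_nonneg_right hηK hNa
    nlinarith

/-! ### Multipliers -/

lemma memL2_of_supp (a : ℕ →₀ ℝ) {f : RSeq} (hf : ∀ k, a k = 0 → f k = 0) : memL2 f := by
  apply summable_of_ne_finset_zero (s := a.support)
  intro b hb
  simp [hf b (Finsupp.notMem_support_iff.1 hb)]

lemma lf_mult (a : ℕ →₀ ℝ) (t : RSeq) {δ M : ℝ} (hδ : 0 < δ) (h1 : ∀ k, δ ≤ t k)
    (h2 : ∀ k, t k ≤ M) :
    l2norm (KP (fun k => a k * t k)) ≤ M * l2norm (KP a)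
      + (2 * M * (Real.log M - Real.log δ)) * l2norm a ∧
    δ * l2norm (KP a) ≤ l2norm (KP (fun k => a k * t k))
      + (2 * M * (Real.log M - Real.log δ)) * l2norm a := by
  have hM : 0 < M := hδ.trans_le ((h1 0).trans (h2 0))
  have ht : ∀ k, 0 < t k := fun k => hδ.trans_le (h1 k)
  have htM : ∀ k, |t k| ≤ M := fun k => by rw [abs_of_pos (ht k)]; exact h2 k
  have hlog : Real.log δ ≤ Real.log M := Real.log_le_log hδ ((h1 0).trans (h2 0))
  have hD : 0 ≤ 2 * M * (Real.log M - Real.log δ) := by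
    have : 0 ≤ Real.log M - Real.log δ := by linarith
    positivity
  set D := 2 * M * (Real.log M - Real.log δ) with hDdef
  have hma := memL2_finsupp a
  have hmb : memL2 (fun k => a k * t k) := memL2_of_supp a (fun k h => by simp [h])
  have hBM := l2norm_mul_le hma htM
  have hBδ := le_l2norm_mul hmb hδ.le h1
  set b : RSeq := fun k => a k * t k with hb
  set A := l2norm a with hA
  set B := l2norm b with hB
  have hmKa : memL2 (KP a) := memL2_of_supp a (fun k h => by simp [KP, h])
  have hmtKa : memL2 (fun k => KP a k * t k) := memL2_of_supp a (fun k h => by simp [KP, h])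
  have hmKb : memL2 (KP b) := memL2_of_supp a (fun k h => by simp [KP, hb, h])
  have hd : ∀ k, |(KP b - fun k => KP a k * t k) k| ≤ |(D • (a : RSeq)) k| := by
    intro k
    rcases eq_or_ne (a k) 0 with h | h
    · simp [KP, hb, h]
    have hApos : 0 < A := l2norm_pos hma h
    have hBpos : 0 < B := lt_of_lt_of_le (by positivity) hBδ
    have e : (KP b - fun k => KP a k * t k) k =
        2 * a k * t k * (Real.log (t k) - Real.log (B / A)) := by
      simp only [Pi.sub_apply, KP, ← hB, ← hA]
      simp only [hb]
      rw [abs_mul, abs_of_pos (ht k), Real.log_div (by have := ht k; positivity) hBpos.ne',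
        Real.log_mul (abs_pos.2 h).ne' (ht k).ne', Real.log_div (abs_pos.2 h).ne' hApos.ne',
        Real.log_div hBpos.ne' hApos.ne']
      ring
    rw [e]
    simp only [Pi.smul_apply, smul_eq_mul, abs_mul, abs_two, abs_of_nonneg hD]
    have l1 := Real.log_le_log hδ (h1 k)
    have l2 := Real.log_le_log (ht k) (h2 k)
    have l3 : Real.log δ ≤ Real.log (B / A) :=
      Real.log_le_log hδ ((le_div_iff₀ hApos).2 hBδ)
    have l4 : Real.log (B / A) ≤ Real.log M :=
      Real.log_le_log (div_pos hBpos hApos) ((div_le_iff₀ hApos).2 hBM)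
    have l5 : |Real.log (t k) - Real.log (B / A)| ≤ Real.log M - Real.log δ := by
      rw [abs_le]; constructor <;> linarith
    calc 2 * |a k| * |t k| * |Real.log (t k) - Real.log (B / A)|
        ≤ 2 * |a k| * M * (Real.log M - Real.log δ) := by
          gcongr
          exact htM k
      _ = D * |a k| := by rw [hDdef]; ring
  have hdm := memL2_mono (memL2_smul D hma) hd
  have hdn := l2norm_mono (memL2_smul D hma) hd
  rw [l2norm_smul, abs_of_nonneg hD] at hdn
  have u1 := l2norm_mul_le hmKa htM
  have u2 := le_l2norm_mul hmtKa hδ.le h1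
  have u3 := l2norm_add_le hdm hmtKa
  rw [sub_add_cancel] at u3
  have u4 := l2norm_sub_le hmKb hdm
  rw [sub_sub_cancel] at u4
  constructor <;> linarith

/-! ### Combinations of blocks -/

lemma lc_fst (w : ℕ → RSeq × RSeq) (a : ℕ →₀ ℝ) :
    (Finsupp.linearCombination ℝ w a).1 = Finsupp.linearCombination ℝ (fun k => (w k).1) a := by
  simp only [Finsupp.linearCombination_apply, Finsupp.sum, Prod.fst_sum, Prod.smul_fst]

lemma lc_snd (w : ℕ → RSeq × RSeq) (a : ℕ →₀ ℝ) :
    (Finsupp.linearCombination ℝ w a).2 = Finsupp.linearCombination ℝ (fun k => (w k).2) a := by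
  simp only [Finsupp.linearCombination_apply, Finsupp.sum, Prod.snd_sum, Prod.smul_snd]

lemma block_formula {w : ℕ → RSeq × RSeq} (hw : ∀ k, memZ2 (w k)) {κ : ℕ → ℕ}
    (hκ : ∀ k j, κ j ≠ k → (w k).1 j = 0 ∧ (w k).2 j = 0) {M : ℝ} (hM : ∀ k, Z2norm (w k) ≤ M)
    (a : ℕ →₀ ℝ) :
    l2norm (Finsupp.linearCombination ℝ w a).2 = l2norm (fun k => a k * l2norm (w k).2) ∧
    Z2norm (Finsupp.linearCombination ℝ w a) ≤ lfNorm (fun k => a k * l2norm (w k).2)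
      + M * l2norm a ∧
    lfNorm (fun k => a k * l2norm (w k).2) ≤ Z2norm (Finsupp.linearCombination ℝ w a)
      + M * l2norm a := by
  set t : RSeq := fun k => l2norm (w k).2 with ht
  set b : RSeq := fun k => a k * t k with hb
  have hx : ∀ k, memL2 ((fun k => (w k).2) k) := fun k => (hw k).1
  have hy : ∀ k, memL2 ((fun k => (w k).1 - KP (w k).2) k) := fun k => (hw k).2
  have hxs : ∀ k j, κ j ≠ k → (fun k => (w k).2) k j = 0 := fun k j h => (hκ k j h).2
  have hys : ∀ k j, κ j ≠ k → (fun k => (w k).1 - KP (w k).2) k j = 0 := fun k j h => by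
    simp [KP, (hκ k j h).1, (hκ k j h).2]
  have hB : l2norm (Finsupp.linearCombination ℝ w a).2 = l2norm b := by
    rw [lc_snd, l2norm_lc_disj hxs hx]
  let c : ℕ →₀ ℝ := Finsupp.onFinset a.support
    (fun k => 2 * a k * Real.log (|a k * t k| / l2norm b)) (fun k h => by
      rw [Finsupp.mem_support_iff]; intro h0; apply h; simp [h0])
  have hc : ∀ k, c k = 2 * a k * Real.log (|a k * t k| / l2norm b) := fun k => rfl
  have hmb : memL2 b := memL2_of_supp a (fun k h => by simp [hb, h])
  have hg : l2norm (Finsupp.linearCombination ℝ (fun k => (w k).2) c) = l2norm (KP b) := by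
    rw [l2norm_lc_disj hxs hx]
    congr 1
    funext k
    rw [hc]
    simp only [KP, hb, ht]
    ring
  have hyn : l2norm (Finsupp.linearCombination ℝ (fun k => (w k).1 - KP (w k).2) a)
      ≤ M * l2norm a := by
    rw [l2norm_lc_disj hys hy]
    apply l2norm_mul_le (memL2_finsupp a)
    intro k
    rw [abs_of_nonneg (l2norm_nonneg _)]
    exact (l2norm_y_le _).trans (hM k)
  have e : (Finsupp.linearCombination ℝ w a).1 - KP (Finsupp.linearCombination ℝ w a).2 =
      Finsupp.linearCombination ℝ (fun k => (w k).1 - KP (w k).2) a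
        - Finsupp.linearCombination ℝ (fun k => (w k).2) c := by
    funext j
    rw [Pi.sub_apply, Pi.sub_apply, lc_apply_disj hys, lc_apply_disj hxs, lc_fst,
      lc_apply_disj (fun k j h => (hκ k j h).1)]
    simp only [KP, hB]
    rw [lc_snd, lc_apply_disj hxs, hc]
    simp only [Pi.sub_apply, KP]
    rcases eq_or_ne (a (κ j)) 0 with h | h
    · simp [h]
    rcases eq_or_ne ((w (κ j)).2 j) 0 with h' | h'
    · simp [h']
    have htp : 0 < t (κ j) := l2norm_pos (hw (κ j)).1 h'
    have hbp : 0 < l2norm b := l2norm_pos hmb (j := κ j) (mul_ne_zero h htp.ne')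
    change _ = a (κ j) * ((w (κ j)).1 j - 2 * (w (κ j)).2 j *
      Real.log (|(w (κ j)).2 j| / t (κ j))) - _
    rw [abs_mul, abs_mul, abs_of_pos htp, Real.log_div (by positivity) hbp.ne',
      Real.log_div (by positivity) hbp.ne', Real.log_div (by positivity) htp.ne',
      Real.log_mul (by positivity) (by positivity), Real.log_mul (by positivity) htp.ne']
    ring
  have my := memL2_lc hy a
  have mg := memL2_lc hx c
  refine ⟨hB, ?_, ?_⟩
  · unfold Z2norm lfNorm
    rw [e, hB]
    have := l2norm_sub_le my mg
    linarith
  · unfold Z2norm lfNorm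
    rw [e, hB]
    have := l2norm_sub_le my (memL2_sub my mg)
    rw [sub_sub_cancel] at this
    linarith

lemma block_lf {δ M : ℝ} (hδ : 0 < δ) (hM0 : 0 < M) : ∃ C K : ℝ, 0 < K ∧
    ∀ w : ℕ → RSeq × RSeq, (∀ k, memZ2 (w k)) → ∀ κ : ℕ → ℕ,
    (∀ k j, κ j ≠ k → (w k).1 j = 0 ∧ (w k).2 j = 0) → (∀ k, Z2norm (w k) ≤ M) →
    (∀ k, δ ≤ l2norm (w k).2) → ∀ a : ℕ →₀ ℝ,
    Z2norm (Finsupp.linearCombination ℝ w a) ≤ C * lfNorm a ∧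
    lfNorm a ≤ K * Z2norm (Finsupp.linearCombination ℝ w a) := by
  by_cases hδM : δ ≤ M
  swap
  · refine ⟨0, 1, one_pos, ?_⟩
    intro w _ _ _ h1 h2
    exact absurd ((h2 0).trans ((l2norm_snd_le _).trans (h1 0))) hδM
  set D := 2 * M * (Real.log M - Real.log δ) with hD
  have hD0 : 0 ≤ D := by
    have := Real.log_le_log hδ hδM
    have : 0 ≤ Real.log M - Real.log δ := by linarith
    positivity
  refine ⟨2 * M + D, (1 + (M + D) / δ) / δ + 1 / δ, by positivity, ?_⟩
  intro w hw κ hκ hM hx a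
  obtain ⟨f1, f2, f3⟩ := block_formula hw hκ hM a
  have htM : ∀ k, l2norm (w k).2 ≤ M := fun k => (l2norm_snd_le _).trans (hM k)
  obtain ⟨g1, g2⟩ := lf_mult a (fun k => l2norm (w k).2) hδ hx htM
  rw [← hD] at g1 g2
  have hB1 : l2norm (fun k => a k * l2norm (w k).2) ≤ M * l2norm a :=
    l2norm_mul_le (memL2_finsupp a) (fun k => by rw [abs_of_nonneg (l2norm_nonneg _)]; exact htM k)
  have hB2 : δ * l2norm a ≤ l2norm (fun k => a k * l2norm (w k).2) :=
    le_l2norm_mul (memL2_of_supp a (fun k h => by simp [h])) hδ.le hx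
  have hZ := l2norm_snd_le (Finsupp.linearCombination ℝ w a)
  set Z := Z2norm (Finsupp.linearCombination ℝ w a)
  unfold lfNorm at *
  have p1 := l2norm_nonneg (KP a)
  have p2 := l2norm_nonneg (a : RSeq)
  constructor
  · have : 0 ≤ M * l2norm (KP a) := by positivity
    have : 0 ≤ D * l2norm (KP a) := by positivity
    linarith
  · have ha : l2norm a ≤ Z / δ := by
      rw [le_div_iff₀ hδ]; linarith
    have hk : l2norm (KP a) ≤ (Z + (M + D) * (Z / δ)) / δ := by
      rw [le_div_iff₀ hδ]
      have : (M + D) * l2norm a ≤ (M + D) * (Z / δ) := by gcongr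
      have := l2norm_nonneg (fun k => a k * l2norm (w k).2)
      linarith
    calc l2norm (KP a) + l2norm a ≤ (Z + (M + D) * (Z / δ)) / δ + Z / δ := add_le_add hk ha
      _ = _ := by field_simp

lemma l2_le_lf (a : RSeq) : l2norm a ≤ lfNorm a := by
  unfold lfNorm
  have := l2norm_nonneg (KP a)
  linarith

lemma estimate_lf {v : ℕ → RSeq × RSeq} (hm : ∀ k, memZ2 (v k)) {M : ℝ}
    (hM : ∀ k, Z2norm (v k) ≤ M) (h0 : Filter.Tendsto v Filter.atTop (nhds 0))
    {δ : ℝ} (hδ : 0 < δ) (hx : ∀ k, δ ≤ l2norm (v k).2) :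
    ∃ φ : ℕ → ℕ, StrictMono φ ∧ UpperE lfNorm (v ∘ φ) ∧ LowerE lfNorm (v ∘ φ) := by
  have hM0 : 0 ≤ M := (Z2norm_nonneg _).trans (hM 0)
  obtain ⟨C, K, hK, hCK⟩ := block_lf (half_pos hδ) (show 0 < 13 * (M + 1) by positivity)
  set η := min (min 1 (δ / 2)) (1 / (26 * K)) with hη
  have hη0 : 0 < η := by
    apply lt_min (lt_min one_pos (half_pos hδ)); positivity
  have hη1 : η ≤ 1 := (min_le_left _ _).trans (min_le_left _ _)
  have hη2 : η ≤ δ / 2 := (min_le_left _ _).trans (min_le_right _ _)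
  have hη3 : 26 * K * η ≤ 1 := by
    have : η ≤ 1 / (26 * K) := min_le_right _ _
    rw [le_div_iff₀ (by positivity)] at this
    linarith
  obtain ⟨φ, hφ, κ, hb⟩ := block_lemma hm hM h0 (fun k => η / 26 ^ (k + 1))
    (fun k => by positivity)
  refine ⟨φ, hφ, ?_⟩
  let w : ℕ → RSeq × RSeq := fun k => restrZ {j | κ j = k} (v (φ k))
  let p : ℕ → RSeq × RSeq := fun k => restrZ {j | κ j = k}ᶜ (v (φ k))
  have hwp : v ∘ φ = fun k => w k + p k := by
    funext k; exact (restrZ_add_compl _ _).symm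
  have hw : ∀ k, memZ2 (w k) := fun k => (restrZ_mem _ (hm _)).1
  have hp : ∀ k, memZ2 (p k) := fun k => (restrZ_mem _ (hm _)).1
  have hpη : ∀ k, Z2norm (p k) ≤ η := fun k => (hb k).trans (by
    apply div_le_self hη0.le
    exact one_le_pow₀ (by norm_num))
  have hwe : ∀ k, w k = v (φ k) - p k := fun k => by
    rw [eq_sub_iff_add_eq]; exact restrZ_add_compl _ _
  have hwM : ∀ k, Z2norm (w k) ≤ 13 * (M + 1) := fun k => by
    rw [hwe]
    have := (Z2_sub (hm (φ k)) (hp k)).2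
    have := hM (φ k)
    have := hpη k
    linarith
  have hwδ : ∀ k, δ / 2 ≤ l2norm (w k).2 := fun k => by
    have h1 := l2norm_add_le (hw k).1 (hp k).1
    have h2 : (w k).2 + (p k).2 = (v (φ k)).2 := by
      rw [← Prod.snd_add]; exact congrArg Prod.snd (restrZ_add_compl _ _)
    rw [h2] at h1
    have := hx (φ k)
    have := (l2norm_snd_le (p k)).trans (hpη k)
    linarith
  have hκ : ∀ k j, κ j ≠ k → (w k).1 j = 0 ∧ (w k).2 j = 0 := fun k j h => by
    simp [w, restrZ, restr, h]
  have := hCK w hw κ hκ hwM hwδ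
  rw [hwp]
  exact perturb (fun a => l2_le_lf a) hw hp hη0.le hK hη3 hb (fun a => (this a).1)
    (fun a => (this a).2)

lemma estimate_l2 {v : ℕ → RSeq × RSeq} (hm : ∀ k, memZ2 (v k)) {M : ℝ}
    (hM : ∀ k, Z2norm (v k) ≤ M) (h0 : Filter.Tendsto v Filter.atTop (nhds 0))
    {δ : ℝ} (hδ : 0 < δ) (hv : ∀ k, δ ≤ Z2norm (v k))
    (hx : Filter.Tendsto (fun k => l2norm (v k).2) Filter.atTop (nhds 0)) :
    ∃ φ : ℕ → ℕ, StrictMono φ ∧ UpperE l2norm (v ∘ φ) ∧ LowerE l2norm (v ∘ φ) := by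
  have hM0 : 0 ≤ M := (Z2norm_nonneg _).trans (hM 0)
  set K := 2 / δ with hKdef
  have hK : 0 < K := by positivity
  set η := min (δ / 4) (1 / (26 * K)) with hη
  have hη0 : 0 < η := by
    apply lt_min (by positivity); positivity
  have hη2 : η ≤ δ / 4 := min_le_left _ _
  have hη3 : 26 * K * η ≤ 1 := by
    have : η ≤ 1 / (26 * K) := min_le_right _ _
    rw [le_div_iff₀ (by positivity)] at this
    linarith
  obtain ⟨ψ, hψ, hψx⟩ := Filter.extraction_forall_of_eventually
    (P := fun k m => l2norm (v m).2 ≤ η / 26 ^ (k + 1) / 26)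
    (fun k => hx.eventually (ge_mem_nhds (by positivity)))
  let y : ℕ → RSeq := fun k => (v (ψ k)).1 - KP (v (ψ k)).2
  have hy : ∀ k, memL2 (y k) := fun k => (hm _).2
  have hyM : ∀ k, Z2norm (y k, 0) ≤ M := fun k => by
    rw [(Z2_pair_zero (hy k)).2]; exact (l2norm_y_le _).trans (hM _)
  have hy0 : Filter.Tendsto (fun k => ((y k, 0) : RSeq × RSeq)) Filter.atTop (nhds 0) := by
    apply Filter.Tendsto.prodMk_nhds (x := (0 : RSeq)) (y := (0 : RSeq)) _ tendsto_const_nhds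
    rw [tendsto_pi_nhds]
    intro j
    exact ((Z2y_tendsto hm hM h0 j).1).comp hψ.tendsto_atTop
  obtain ⟨φ, hφ, κ, hb⟩ := block_lemma (fun k => (Z2_pair_zero (hy k)).1) hyM hy0
    (fun k => η / 26 ^ (k + 1) / 26) (fun k => by positivity)
  refine ⟨ψ ∘ φ, hψ.comp hφ, ?_⟩
  let w : ℕ → RSeq × RSeq := fun k => restrZ {j | κ j = k} (y (φ k), 0)
  let p1 : ℕ → RSeq × RSeq := fun k => restrZ {j | κ j = k}ᶜ (y (φ k), 0)
  let p2 : ℕ → RSeq × RSeq := fun k => (KP (v (ψ (φ k))).2, (v (ψ (φ k))).2)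
  let p : ℕ → RSeq × RSeq := fun k => p1 k + p2 k
  have hwp : v ∘ (ψ ∘ φ) = fun k => w k + p k := by
    funext k
    change v (ψ (φ k)) = w k + (p1 k + p2 k)
    rw [← add_assoc, restrZ_add_compl]
    exact Z2_split
  have hw : ∀ k, memZ2 (w k) := fun k => (restrZ_mem _ (Z2_pair_zero (hy _)).1).1
  have hp1 : ∀ k, memZ2 (p1 k) := fun k => (restrZ_mem _ (Z2_pair_zero (hy _)).1).1
  have hp2 : ∀ k, memZ2 (p2 k) := fun k => (Z2_KP (hm _).1).1
  have hp : ∀ k, memZ2 (p k) := fun k => (Z2_add (hp1 k) (hp2 k)).1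
  have hpn : ∀ k, Z2norm (p k) ≤ η / 26 ^ (k + 1) := fun k => by
    have h1 := (Z2_add (hp1 k) (hp2 k)).2
    have h2 := hb k
    have h3 : Z2norm (p2 k) = _ := (Z2_KP (hm (ψ (φ k))).1).2
    have h4 := hψx (φ k)
    have h5 : η / 26 ^ (φ k + 1) / 26 ≤ η / 26 ^ (k + 1) / 26 := by
      have := hφ.id_le k
      gcongr
      · norm_num
      · exact this
    have h6 : Z2norm (p1 k) ≤ η / 26 ^ (k + 1) / 26 := h2
    have h7 : Z2norm (p k) ≤ 13 * (Z2norm (p1 k) + Z2norm (p2 k)) := h1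
    linarith
  have hw2 : ∀ k, (w k).2 = 0 := fun k => by
    funext j; simp [w, restrZ, restr]
  have hw1 : ∀ k, (w k).1 = restr {j | κ j = k} (y (φ k)) := fun k => rfl
  have hwm : ∀ k, memL2 ((fun k => (w k).1) k) := fun k => memL2_restr _ (hy _)
  have hsmall : ∀ k, η / 26 ^ (k + 1) / 26 ≤ η / 26 := fun k => by
    have : η / 26 ^ (k + 1) ≤ η := by
      apply div_le_self hη0.le
      exact one_le_pow₀ (by norm_num)
    linarith
  have hwM : ∀ k, |l2norm (w k).1| ≤ M := fun k => by
    rw [abs_of_nonneg (l2norm_nonneg _)]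
    have := l2norm_restr_le {j | κ j = k} (hy (φ k))
    have h2 := hyM (φ k)
    rw [(Z2_pair_zero (hy _)).2] at h2
    exact this.trans h2
  have hwδ : ∀ k, δ / 2 ≤ l2norm (w k).1 := fun k => by
    have e : (w k).1 + (p1 k).1 = y (φ k) := by
      rw [← Prod.fst_add]; exact congrArg Prod.fst (restrZ_add_compl _ _)
    have hp1m : memL2 (p1 k).1 := memL2_restr _ (hy _)
    have h1 := l2norm_add_le (hwm k) hp1m
    rw [e] at h1
    have h2 : Z2norm (p1 k) = l2norm (p1 k).1 := by
      have : p1 k = ((p1 k).1, 0) := by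
        ext j
        · rfl
        · simp [p1, restrZ, restr]
      rw [this, (Z2_pair_zero hp1m).2]
    have h3 : Z2norm (p1 k) ≤ _ := (hb k).trans (hsmall k)
    have h4 := hv (ψ (φ k))
    have h5 := hψx (φ k)
    have h6 := hsmall (φ k)
    have h7 : Z2norm (v (ψ (φ k))) = l2norm (y (φ k)) + l2norm (v (ψ (φ k))).2 := rfl
    linarith
  have hκ : ∀ k j, κ j ≠ k → (fun k => (w k).1) k j = 0 := fun k j h => by
    simp [w, restrZ, restr, h]
  have hform : ∀ a : ℕ →₀ ℝ, Z2norm (Finsupp.linearCombination ℝ w a) =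
      l2norm (fun k => a k * l2norm (w k).1) := by
    intro a
    have e : Finsupp.linearCombination ℝ w a =
        (Finsupp.linearCombination ℝ (fun k => (w k).1) a, 0) := by
      apply Prod.ext
      · exact lc_fst w a
      · rw [lc_snd]
        simp [hw2, Finsupp.linearCombination_apply]
    rw [e, (Z2_pair_zero (memL2_lc hwm a)).2, l2norm_lc_disj hκ hwm]
  rw [hwp]
  refine perturb (C := M) (K := K) (fun a => le_rfl) hw hp hη0.le hK hη3 hpn (fun a => ?_)
    (fun a => ?_)
  · rw [hform]
    exact l2norm_mul_le (memL2_finsupp a) hwM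
  · rw [hform]
    have := le_l2norm_mul (a := a) (t := fun k => l2norm (w k).1)
      (memL2_of_supp a (fun k h => by simp [h])) (half_pos hδ).le hwδ
    rw [hKdef, div_mul_eq_mul_div, le_div_iff₀ hδ]
    linarith

/-! ### Subsequences -/

lemma l2norm_spread {f : ℕ → ℕ} (hf : Function.Injective f) {x z : RSeq}
    (h1 : ∀ k, z (f k) = x k) (h2 : ∀ j, j ∉ Set.range f → z j = 0) : l2norm z = l2norm x := by
  unfold l2norm
  congr 1
  rw [← hf.tsum_eq (f := fun j => z j ^ 2)]
  · simp only [h1]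
  · intro j hj
    by_contra h
    apply hj
    simp [h2 j h]

/-- Invariance under spreading. -/
def Spread (N : RSeq → ℝ) : Prop := ∀ (f : ℕ → ℕ), Function.Injective f → ∀ a : ℕ →₀ ℝ,
  N (Finsupp.mapDomain f a) = N a

lemma spread_l2 : Spread l2norm := fun f hf a =>
  l2norm_spread hf (fun k => Finsupp.mapDomain_apply hf a k)
    (fun j hj => Finsupp.mapDomain_of_notMem_range a j hj)

lemma spread_lf : Spread lfNorm := fun f hf a => by
  unfold lfNorm
  rw [spread_l2 f hf a]
  congr 1
  refine l2norm_spread hf (fun k => ?_) (fun j hj => ?_)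
  · simp only [KP, spread_l2 f hf a, Finsupp.mapDomain_apply hf a k]
  · simp [KP, Finsupp.mapDomain_of_notMem_range a j hj]

lemma UpperE.sub {N : RSeq → ℝ} (hN : Spread N) {v : ℕ → RSeq × RSeq} (h : UpperE N v)
    {f : ℕ → ℕ} (hf : Function.Injective f) : UpperE N (v ∘ f) := by
  obtain ⟨C, hC⟩ := h
  refine ⟨C, fun a => ?_⟩
  have := hC (Finsupp.mapDomain f a)
  rwa [Finsupp.linearCombination_mapDomain, hN f hf a] at this

/-! ### Strict singularity -/

lemma no_iso {T : (RSeq × RSeq) →ₗ[ℝ] (RSeq × RSeq)} (hT : StrictlySingular T)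
    {N : RSeq → ℝ} (hN : ∀ a : ℕ →₀ ℝ, l2norm a ≤ N a) {v : ℕ → RSeq × RSeq}
    (hm : ∀ k, memZ2 (v k)) (hU : UpperE N v) (hL : LowerE N (fun k => T (v k))) : False := by
  obtain ⟨C, hC⟩ := hU
  obtain ⟨K, hK⟩ := hL
  have hTl : ∀ a : ℕ →₀ ℝ, Finsupp.linearCombination ℝ (fun k => T (v k)) a =
      T (Finsupp.linearCombination ℝ v a) := fun a => by
    simp [Finsupp.linearCombination_apply, Finsupp.sum, map_sum]
  have hNn : ∀ a : ℕ →₀ ℝ, 0 ≤ N a := fun a => (l2norm_nonneg _).trans (hN a)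
  have hli : LinearIndependent ℝ v := by
    rw [linearIndependent_iff]
    intro a ha
    have h1 := hK a
    rw [hTl, ha, map_zero, Z2norm_zero, mul_zero] at h1
    ext k
    have h2 := abs_le_l2norm (memL2_finsupp a) k
    have h3 := hN a
    exact abs_nonpos_iff.1 (by linarith)
  have hfin := hT (LinearMap.range (Finsupp.linearCombination ℝ v)) (by
      rintro _ ⟨a, rfl⟩; exact memZ2_lc hm a) (by
      refine ⟨1 / (|C| * |K| + 1), by positivity, ?_⟩
      rintro _ ⟨a, rfl⟩
      have h1 := hC a
      have h2 := hK a
      rw [hTl] at h2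
      have h3 := Z2norm_nonneg (T (Finsupp.linearCombination ℝ v a))
      rw [one_div, inv_mul_le_iff₀ (by positivity)]
      set ZT := Z2norm (T (Finsupp.linearCombination ℝ v a))
      have h4 : C * N a ≤ |C| * N a := mul_le_mul_of_nonneg_right (le_abs_self C) (hNn a)
      have h5 : K * ZT ≤ |K| * ZT := mul_le_mul_of_nonneg_right (le_abs_self K) h3
      have h6 : |C| * N a ≤ |C| * (|K| * ZT) :=
        mul_le_mul_of_nonneg_left (h2.trans h5) (abs_nonneg C)
      linarith)
  have e : (ℕ →₀ ℝ) ≃ₗ[ℝ] LinearMap.range (Finsupp.linearCombination ℝ v) :=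
    LinearEquiv.ofInjective _ hli
  have : FiniteDimensional ℝ (ℕ →₀ ℝ) := Module.Finite.equiv e.symm
  have hlt := Module.finite_finsupp_self_iff (R := ℝ) (ι := ℕ) |>.1 this
  rcases hlt with h | h
  · exact not_subsingleton ℝ h
  · exact not_finite ℕ

lemma tendsto_or {f : ℕ → ℝ} (hf : ∀ k, 0 ≤ f k) :
    Filter.Tendsto f Filter.atTop (nhds 0) ∨
    ∃ δ > 0, ∃ φ : ℕ → ℕ, StrictMono φ ∧ ∀ k, δ ≤ f (φ k) := by
  by_cases h : ∃ δ > 0, ∃ᶠ k in Filter.atTop, δ ≤ f k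
  · right
    obtain ⟨δ, hδ, h⟩ := h
    obtain ⟨φ, hφ, h⟩ := Filter.extraction_of_frequently_atTop h
    exact ⟨δ, hδ, φ, hφ, h⟩
  · left
    rw [Metric.tendsto_nhds]
    intro ε hε
    have : ¬ ∃ᶠ k in Filter.atTop, ε ≤ f k := fun h' => h ⟨ε, hε, h'⟩
    rw [Filter.not_frequently] at this
    filter_upwards [this] with k hk
    rw [Real.dist_eq, sub_zero, abs_of_nonneg (hf k)]
    exact not_le.1 hk

lemma estimate_lower_l2 {v : ℕ → RSeq × RSeq} (hm : ∀ k, memZ2 (v k)) {M : ℝ}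
    (hM : ∀ k, Z2norm (v k) ≤ M) (h0 : Filter.Tendsto v Filter.atTop (nhds 0))
    {δ : ℝ} (hδ : 0 < δ) (hv : ∀ k, δ ≤ Z2norm (v k)) :
    ∃ φ : ℕ → ℕ, StrictMono φ ∧ LowerE l2norm (v ∘ φ) := by
  rcases tendsto_or (fun k => l2norm_nonneg (v k).2) with h | ⟨δ', hδ', φ, hφ, h⟩
  · obtain ⟨φ, hφ, -, hL⟩ := estimate_l2 hm hM h0 hδ hv h
    exact ⟨φ, hφ, hL⟩
  · obtain ⟨ψ, hψ, -, K, hK⟩ := estimate_lf (v := v ∘ φ) (fun k => hm _) (fun k => hM _)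
      (h0.comp hφ.tendsto_atTop) hδ' h
    exact ⟨φ ∘ ψ, hφ.comp hψ, K, fun a => (l2_le_lf a).trans (hK a)⟩

lemma L1 {T : (RSeq × RSeq) →ₗ[ℝ] (RSeq × RSeq)} (hT : StrictlySingular T) (hTb : BoundedOnZ2 T)
    {v : ℕ → RSeq × RSeq} (hm : ∀ k, memZ2 (v k)) {M : ℝ}
    (hM : ∀ k, Z2norm (v k) ≤ M) (h0 : Filter.Tendsto v Filter.atTop (nhds 0))
    (hT0 : Filter.Tendsto (fun k => T (v k)) Filter.atTop (nhds 0))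
    (hx : Filter.Tendsto (fun k => l2norm (v k).2) Filter.atTop (nhds 0))
    {δ : ℝ} (hδ : 0 < δ) (hv : ∀ k, δ ≤ Z2norm (T (v k))) : False := by
  obtain ⟨hTm, C, hC⟩ := hTb
  have hC' : ∀ u, memZ2 u → Z2norm (T u) ≤ (|C| + 1) * Z2norm u := fun u hu => by
    refine (hC u hu).trans ?_
    have := Z2norm_nonneg u
    have := le_abs_self C
    gcongr
    linarith
  have hv' : ∀ k, δ / (|C| + 1) ≤ Z2norm (v k) := fun k => by
    rw [div_le_iff₀ (by positivity)]
    have h1 := hv k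
    have h2 := hC' _ (hm k)
    linarith
  obtain ⟨φ, hφ, hU, -⟩ := estimate_l2 hm hM h0 (by positivity) hv' hx
  have hTM : ∀ k, Z2norm (T (v k)) ≤ (|C| + 1) * M := fun k =>
    (hC' _ (hm k)).trans (mul_le_mul_of_nonneg_left (hM k) (by positivity))
  obtain ⟨ψ, hψ, hL⟩ := estimate_lower_l2 (v := fun k => T (v (φ k))) (fun k => hTm _ (hm _))
    (fun k => hTM _) (hT0.comp hφ.tendsto_atTop) hδ (fun k => hv _)
  exact no_iso hT (N := l2norm) (fun a => le_rfl) (v := (v ∘ φ) ∘ ψ) (fun k => hm _)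
    (hU.sub spread_l2 hψ.injective) hL

lemma L2 {T : (RSeq × RSeq) →ₗ[ℝ] (RSeq × RSeq)} (hT : StrictlySingular T) (hTb : BoundedOnZ2 T)
    {v : ℕ → RSeq × RSeq} (hm : ∀ k, memZ2 (v k)) {M : ℝ}
    (hM : ∀ k, Z2norm (v k) ≤ M) (h0 : Filter.Tendsto v Filter.atTop (nhds 0))
    (hT0 : Filter.Tendsto (fun k => T (v k)) Filter.atTop (nhds 0))
    {δ : ℝ} (hδ : 0 < δ) (hv : ∀ k, δ ≤ l2norm (T (v k)).2) : False := by
  rcases tendsto_or (fun k => l2norm_nonneg (v k).2) with h | ⟨δ', hδ', φ, hφ, h⟩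
  · exact L1 hT hTb hm hM h0 hT0 h hδ (fun k => (hv k).trans (l2norm_snd_le _))
  obtain ⟨ψ, hψ, hU, -⟩ := estimate_lf (v := v ∘ φ) (fun k => hm _) (fun k => hM _)
      (h0.comp hφ.tendsto_atTop) hδ' h
  obtain ⟨hTm, C, hC⟩ := hTb
  have hTM : ∀ k, Z2norm (T (v k)) ≤ |C| * M := fun k => by
    refine (hC _ (hm k)).trans ?_
    have := Z2norm_nonneg (v k)
    exact (mul_le_mul_of_nonneg_right (le_abs_self C) this).trans
      (mul_le_mul_of_nonneg_left (hM k) (abs_nonneg C))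
  obtain ⟨χ, hχ, -, hL⟩ := estimate_lf (v := fun k => T (v (φ (ψ k)))) (fun k => hTm _ (hm _))
    (fun k => hTM _) (hT0.comp (hφ.comp hψ).tendsto_atTop) hδ (fun k => hv _)
  exact no_iso hT (N := lfNorm) (fun a => l2_le_lf a) (v := ((v ∘ φ) ∘ ψ) ∘ χ) (fun k => hm _)
    (hU.sub spread_lf hχ.injective) hL

/-! ### The product of two strictly singular operators -/

/-- Coordinate box. -/
def box (R : ℝ) : Set (RSeq × RSeq) :=
  (Set.univ.pi fun _ => Set.Icc (-R) R) ×ˢ (Set.univ.pi fun _ => Set.Icc (-R) R)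

lemma isCompact_box (R : ℝ) : IsCompact (box R) :=
  (isCompact_univ_pi fun _ => isCompact_Icc).prod (isCompact_univ_pi fun _ => isCompact_Icc)

lemma mem_box {u : RSeq × RSeq} (hu : memZ2 u) {R : ℝ} (hR : Z2norm u ≤ R) : u ∈ box (2 * R) := by
  have hn := Z2norm_nonneg u
  constructor
  · intro j _
    have := abs_le.1 ((abs_fst_le hu j).trans (show 2 * Z2norm u ≤ 2 * R by linarith))
    exact this
  · intro j _
    have := abs_le.1 ((abs_snd_le hu j).trans (show Z2norm u ≤ 2 * R by linarith))
    exact this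

lemma product_compact (S T : (RSeq × RSeq) →ₗ[ℝ] (RSeq × RSeq)) (hSb : BoundedOnZ2 S)
    (hTb : BoundedOnZ2 T) (hS : StrictlySingular S) (hT : StrictlySingular T) :
    CompactOnZ2 (fun u => S (T u)) := by
  by_contra hcon
  unfold CompactOnZ2 at hcon
  push Not at hcon
  obtain ⟨ε, hε, hcon⟩ := hcon
  obtain ⟨hTm, C, hC⟩ := id hTb
  obtain ⟨hSm, D, hD⟩ := id hSb
  have hST : ∀ u, memZ2 u → memZ2 (S (T u)) := fun u hu => hSm _ (hTm _ hu)
  obtain ⟨u, hu, hsep⟩ := exists_seq_of_forall_finset_exists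
    (fun u : RSeq × RSeq => memZ2 u ∧ Z2norm u ≤ 1)
    (fun u v => ε ≤ Z2norm (S (T v) - S (T u))) (fun s hs => by
      classical
      obtain ⟨u, hu, hu1, h⟩ := hcon ((fun u => S (T u)) '' (s : Set (RSeq × RSeq)))
        (s.finite_toSet.image _)
      refine ⟨u, ⟨hu, hu1⟩, fun x hx => h _ ⟨x, hx, rfl⟩ ?_⟩
      exact (Z2_sub (hST _ hu) (hST _ (hs x hx).1)).1)
  have hTn : ∀ w, memZ2 w → ∀ B, Z2norm w ≤ B → Z2norm (T w) ≤ |C| * B := fun w hw B hB =>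
    (hC _ hw).trans ((mul_le_mul_of_nonneg_right (le_abs_self C) (Z2norm_nonneg w)).trans
      (mul_le_mul_of_nonneg_left hB (abs_nonneg C)))
  have hSn : ∀ w, memZ2 w → ∀ B, Z2norm w ≤ B → Z2norm (S w) ≤ |D| * B := fun w hw B hB =>
    (hD _ hw).trans ((mul_le_mul_of_nonneg_right (le_abs_self D) (Z2norm_nonneg w)).trans
      (mul_le_mul_of_nonneg_left hB (abs_nonneg D)))
  have hbox : ∀ n, (u n, T (u n), S (T (u n))) ∈
      box (2 * 1) ×ˢ (box (2 * (|C| * 1)) ×ˢ box (2 * (|D| * (|C| * 1)))) := fun n =>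
    ⟨mem_box (hu n).1 (hu n).2, mem_box (hTm _ (hu n).1) (hTn _ (hu n).1 _ (hu n).2),
      mem_box (hST _ (hu n).1) (hSn _ (hTm _ (hu n).1) _ (hTn _ (hu n).1 _ (hu n).2))⟩
  obtain ⟨⟨a, b, c⟩, -, φ, hφ, hlim⟩ := ((isCompact_box _).prod
    ((isCompact_box _).prod (isCompact_box _))).tendsto_subseq hbox
  have la : Filter.Tendsto (fun k => u (φ k)) Filter.atTop (nhds a) :=
    (continuous_fst.tendsto _).comp hlim
  have lb : Filter.Tendsto (fun k => T (u (φ k))) Filter.atTop (nhds b) :=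
    ((continuous_fst.comp continuous_snd).tendsto _).comp hlim
  have lc : Filter.Tendsto (fun k => S (T (u (φ k)))) Filter.atTop (nhds c) :=
    ((continuous_snd.comp continuous_snd).tendsto _).comp hlim
  let v : ℕ → RSeq × RSeq := fun k => u (φ (k + 1)) - u (φ k)
  have hvm : ∀ k, memZ2 (v k) := fun k => (Z2_sub (hu _).1 (hu _).1).1
  have hvM : ∀ k, Z2norm (v k) ≤ 26 := fun k => by
    have h1 : Z2norm (v k) ≤ _ := (Z2_sub (hu (φ (k + 1))).1 (hu (φ k)).1).2
    have := (hu (φ (k + 1))).2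
    have := (hu (φ k)).2
    linarith
  have v0 : Filter.Tendsto v Filter.atTop (nhds 0) := by
    have := (la.comp (Filter.tendsto_add_atTop_nat 1)).sub la
    rwa [sub_self] at this
  have Tv0 : Filter.Tendsto (fun k => T (v k)) Filter.atTop (nhds 0) := by
    have := (lb.comp (Filter.tendsto_add_atTop_nat 1)).sub lb
    rw [sub_self] at this
    simpa [v] using this
  have STv0 : Filter.Tendsto (fun k => S (T (v k))) Filter.atTop (nhds 0) := by
    have := (lc.comp (Filter.tendsto_add_atTop_nat 1)).sub lc
    rw [sub_self] at this
    simpa [v] using this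
  have hlow : ∀ k, ε ≤ Z2norm (S (T (v k))) := fun k => by
    have := hsep (φ k) (φ (k + 1)) (hφ (Nat.lt_succ_self k))
    simpa [v] using this
  rcases tendsto_or (fun k => l2norm_nonneg (T (v k)).2) with h | ⟨δ, hδ, ψ, hψ, h⟩
  · exact L1 hS hSb (v := fun k => T (v k)) (fun k => hTm _ (hvm k))
      (fun k => hTn _ (hvm k) _ (hvM k)) Tv0 STv0 h hε hlow
  · exact L2 hT hTb (v := v ∘ ψ) (fun k => hvm _) (fun k => hvM _)
      (v0.comp hψ.tendsto_atTop) (Tv0.comp hψ.tendsto_atTop) hδ h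

/-! ### The operator `(ω, x) ↦ (x, 0)` -/

lemma part_bounded : BoundedOnZ2 (fun u : RSeq × RSeq => (u.2, (0 : RSeq))) := by
  refine ⟨fun u hu => (Z2_pair_zero hu.1).1, 1, fun u hu => ?_⟩
  rw [(Z2_pair_zero hu.1).2, one_mul]
  exact l2norm_snd_le u

lemma l2_single (n : ℕ) : l2norm (Pi.single n 1 : RSeq) = 1 := by
  unfold l2norm
  rw [tsum_eq_single n]
  · simp
  · intro b hb; simp [hb]

lemma memL2_single (n : ℕ) : memL2 (Pi.single n 1 : RSeq) := by
  apply summable_of_ne_finset_zero (s := {n})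
  intro b hb
  simp at hb
  simp [hb]

lemma KP_single (n : ℕ) : KP (Pi.single n 1 : RSeq) = 0 := by
  funext j
  simp only [KP, l2_single]
  by_cases h : j = n
  · subst h; simp
  · simp [h]

lemma part_not_compact : ¬ CompactOnZ2 (fun u : RSeq × RSeq => (u.2, (0 : RSeq))) := by
  intro h
  obtain ⟨S, hS, h⟩ := h (1 / 26) (by norm_num)
  have h' : ∀ n : ℕ, ∃ s ∈ S, memZ2 (((Pi.single n 1 : RSeq), (0 : RSeq)) - s) ∧
      Z2norm (((Pi.single n 1 : RSeq), (0 : RSeq)) - s) < 1 / 26 := by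
    intro n
    refine h (0, Pi.single n 1) ⟨memL2_single n, ?_⟩ ?_
    · simp only [KP_single]
      simpa using memL2_zero
    · simp [Z2norm, KP_single, l2_single]
  choose s hs hs1 hs2 using h'
  obtain ⟨m, n, hmn, hse⟩ : ∃ m n, m ≠ n ∧ s m = s n := by
    have : Finite S := hS
    obtain ⟨m, n, hmn, e⟩ := Finite.exists_ne_map_eq_of_infinite (fun n => (⟨s n, hs n⟩ : S))
    exact ⟨m, n, hmn, by simpa using e⟩
  have h1 := (Z2_sub (hs1 m) (hs1 n)).2
  have e : (((Pi.single m 1 : RSeq), (0 : RSeq)) - s m) - (((Pi.single n 1 : RSeq), (0 : RSeq)) - s n)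
      = ((Pi.single m 1 - Pi.single n 1 : RSeq), (0 : RSeq)) := by
    rw [hse, sub_sub_sub_cancel_right]; simp
  have hmem := memL2_sub (memL2_single m) (memL2_single n)
  rw [e, (Z2_pair_zero hmem).2] at h1
  have h2 := abs_le_l2norm hmem m
  simp [hmn] at h2
  have := hs2 m
  have := hs2 n
  linarith

lemma exists_tail {V : Submodule ℝ (RSeq × RSeq)} (hV : ¬ FiniteDimensional ℝ V) (n : ℕ) :
    ∃ v ∈ V, v ≠ 0 ∧ ∀ j < n, v.1 j = 0 ∧ v.2 j = 0 := by
  by_contra hcon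
  push Not at hcon
  apply hV
  let p : (RSeq × RSeq) →ₗ[ℝ] ((Fin n → ℝ) × (Fin n → ℝ)) :=
    { toFun := fun u => (fun j => u.1 j, fun j => u.2 j)
      map_add' := fun _ _ => rfl
      map_smul' := fun _ _ => rfl }
  apply FiniteDimensional.of_injective (p.comp V.subtype)
  rw [← LinearMap.ker_eq_bot, LinearMap.ker_eq_bot']
  rintro ⟨v, hv⟩ h0
  by_contra hne
  have hne' : v ≠ 0 := fun h => hne (by simp [h])
  obtain ⟨j, hj, h1⟩ := hcon v hv hne'
  have e1 : v.1 j = 0 := congrFun (congrArg Prod.fst h0) ⟨j, hj⟩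
  have e2 : v.2 j = 0 := congrFun (congrArg Prod.snd h0) ⟨j, hj⟩
  exact h1 e1 e2

lemma part_ss : StrictlySingular (fun u : RSeq × RSeq => (u.2, (0 : RSeq))) := by
  intro V hVm ⟨c, hc, hVc⟩
  by_contra hV
  have hVc' : ∀ v ∈ V, c * Z2norm v ≤ l2norm v.2 := fun v hv => by
    have := hVc v hv
    rwa [(Z2_pair_zero (hVm v hv).1).2] at this
  choose v hvV hv0 hvz using exists_tail hV
  have hpos : ∀ n, 0 < l2norm (v n).2 := by
    intro n
    rcases (l2norm_nonneg (v n).2).eq_or_lt with h | h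
    swap
    · exact h
    exfalso
    apply hv0 n
    have h1 := hVc' _ (hvV n)
    rw [← h] at h1
    have h2 : Z2norm (v n) ≤ 0 := by
      by_contra h3
      have := mul_pos hc (not_le.1 h3)
      linarith
    have hm := hVm _ (hvV n)
    ext j
    · have := abs_fst_le hm j
      exact abs_nonpos_iff.1 (by linarith)
    · have := abs_snd_le hm j
      exact abs_nonpos_iff.1 (by linarith)
  let w : ℕ → RSeq × RSeq := fun n => (l2norm (v n).2)⁻¹ • v n
  have hwV : ∀ n, w n ∈ V := fun n => V.smul_mem _ (hvV n)
  have hw1 : ∀ n, l2norm (w n).2 = 1 := fun n => by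
    simp only [w, Prod.smul_snd, l2norm_smul]
    rw [abs_of_pos (inv_pos.2 (hpos n)), inv_mul_cancel₀ (hpos n).ne']
  have hwM : ∀ n, Z2norm (w n) ≤ 1 / c := fun n => by
    rw [le_div_iff₀ hc, mul_comm, ← hw1 n]
    exact hVc' _ (hwV n)
  have hw0 : Filter.Tendsto w Filter.atTop (nhds 0) := by
    have hz : ∀ j, ∀ n, j < n → (w n).1 j = 0 ∧ (w n).2 j = 0 := fun j n hj => by
      simp [w, hvz n j hj]
    apply Filter.Tendsto.prodMk_nhds (mx := fun n => (w n).1) (my := fun n => (w n).2)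
      (x := (0 : RSeq)) (y := (0 : RSeq))
    · rw [tendsto_pi_nhds]
      intro j
      apply tendsto_const_nhds.congr'
      filter_upwards [Filter.eventually_gt_atTop j] with n hn
      exact (hz j n hn).1.symm
    · rw [tendsto_pi_nhds]
      intro j
      apply tendsto_const_nhds.congr'
      filter_upwards [Filter.eventually_gt_atTop j] with n hn
      exact (hz j n hn).2.symm
  obtain ⟨φ, hφ, -, K, hK⟩ := estimate_lf (fun k => hVm _ (hwV k)) hwM hw0 one_pos
    (fun k => (hw1 k).ge)
  have hqm : ∀ k, memL2 (w k).2 := fun k => (hVm _ (hwV k)).1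
  obtain ⟨ψ, hψ, ⟨C, hC⟩, -⟩ := estimate_l2
    (v := fun k => (((w (φ k)).2, (0 : RSeq)) : RSeq × RSeq))
    (fun k => (Z2_pair_zero (hqm _)).1) (M := 1)
    (fun k => by rw [(Z2_pair_zero (hqm _)).2, hw1]) (by
      apply Filter.Tendsto.prodMk_nhds (x := (0 : RSeq)) (y := (0 : RSeq)) _ tendsto_const_nhds
      exact (continuous_snd.tendsto _).comp (hw0.comp hφ.tendsto_atTop)) one_pos
    (fun k => by rw [(Z2_pair_zero (hqm _)).2, hw1]) (by simp)
  have key : ∀ a : ℕ →₀ ℝ, lfNorm a ≤ |K| * (1 / c) * |C| * l2norm a := by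
    intro a
    have h1 := hK (Finsupp.mapDomain ψ a)
    rw [Finsupp.linearCombination_mapDomain, spread_lf ψ hψ.injective a] at h1
    have h2 := hC a
    set u := Finsupp.linearCombination ℝ ((w ∘ φ) ∘ ψ) a with hu
    have huV : u ∈ V := by
      rw [hu, Finsupp.linearCombination_apply]
      exact V.sum_mem (fun k _ => V.smul_mem _ (hwV _))
    have e : Finsupp.linearCombination ℝ
        ((fun k => (((w (φ k)).2, (0 : RSeq)) : RSeq × RSeq)) ∘ ψ) a = (u.2, 0) := by
      apply Prod.ext
      · rw [lc_fst, hu, lc_snd]; rfl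
      · rw [lc_snd]
        simp [Finsupp.linearCombination_apply]
    rw [e, (Z2_pair_zero (hVm u huV).1).2] at h2
    have h3 := hVc' u huV
    have h4 : Z2norm u ≤ 1 / c * (|C| * l2norm a) := by
      rw [one_div, ← div_eq_inv_mul, le_div_iff₀ hc]
      have : C * l2norm a ≤ |C| * l2norm a :=
        mul_le_mul_of_nonneg_right (le_abs_self C) (l2norm_nonneg _)
      linarith
    calc lfNorm a ≤ K * Z2norm u := h1
      _ ≤ |K| * Z2norm u := mul_le_mul_of_nonneg_right (le_abs_self K) (Z2norm_nonneg _)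
      _ ≤ |K| * (1 / c * (|C| * l2norm a)) := mul_le_mul_of_nonneg_left h4 (abs_nonneg K)
      _ = _ := by ring
  set B := |K| * (1 / c) * |C| with hB
  obtain ⟨n, hn⟩ := exists_nat_gt (Real.exp (B + 1))
  have hn0 : (0:ℝ) < n := (Real.exp_pos _).trans hn
  let a : ℕ →₀ ℝ := Finsupp.onFinset (Finset.range n) (fun k => if k < n then 1 else 0)
    (fun k h => by
      rw [Finset.mem_range]; by_contra h'; exact h (if_neg h'))
  have ha : ∀ k, a k = if k < n then 1 else 0 := fun k => rfl
  have han : l2norm a = √n := by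
    unfold l2norm
    congr 1
    rw [tsum_eq_sum (s := Finset.range n)]
    · rw [Finset.sum_congr rfl (g := fun _ => (1:ℝ))]
      · simp
      · intro k hk
        rw [ha, if_pos (Finset.mem_range.1 hk)]; simp
    · intro k hk
      rw [ha, if_neg (fun h => hk (Finset.mem_range.2 h))]; simp
  have hKPa : KP a = (-Real.log n) • (a : RSeq) := by
    funext k
    simp only [KP, han, Pi.smul_apply, smul_eq_mul, ha]
    split_ifs
    · rw [abs_one, one_div, Real.log_inv, Real.log_sqrt hn0.le]; ring
    · simp
  have hk := key a
  unfold lfNorm at hk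
  rw [hKPa, l2norm_smul, han, abs_neg] at hk
  have hlog : B + 1 < Real.log n := by
    rw [Real.lt_log_iff_exp_lt hn0]; exact hn
  have hs : 0 < √(n:ℝ) := Real.sqrt_pos.2 hn0
  have := le_abs_self (Real.log n)
  nlinarith

/-- (1) S(ω,x) = (x,0) is bounded on Z₂, strictly singular and not compact;
(2) the composition of two strictly singular bounded operators on Z₂ is compact. -/
theorem stmt_19 :
    (BoundedOnZ2 (fun u : RSeq × RSeq => (u.2, (0 : RSeq))) ∧
     StrictlySingular (fun u : RSeq × RSeq => (u.2, (0 : RSeq))) ∧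
     ¬ CompactOnZ2 (fun u : RSeq × RSeq => (u.2, (0 : RSeq)))) ∧
    (∀ S T : (RSeq × RSeq) →ₗ[ℝ] (RSeq × RSeq),
      BoundedOnZ2 S → BoundedOnZ2 T →
      StrictlySingular S → StrictlySingular T →
      CompactOnZ2 (fun u => S (T u))) := by
  exact ⟨⟨part_bounded, part_ss, part_not_compact⟩, product_compact⟩
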